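/- Let I ⊆ S be a stable monomial ideal with minimal monomial generators ordered by decreasing lexicographic order (so that I has linear quotients with A_i = {1,...,max(supp(m_i))−1} and is crit-monotone), and let G̃ be the associated Eliahou–Kervaire-type complex, the minimal free resolution of S/I. Then G̃ admits the structure of a differential graded algebra: there exist S-bilinear multiplication maps μ : G̃_p × G̃_q → G̃_{p+q} for all p, q ≥ 0 such that μ agrees with the ring multiplication of S on G̃_0 × G̃_0 = S × S; the element 1 ∈ G̃_0 = S is a two-sided identity; μ is graded-commutative, μ(x,y) = (−1)^{pq} μ(y,x) for x ∈ G̃_p, y ∈ G̃_q; μ is associative; and the Leibniz rule holds: d(μ(x,y)) = μ(d x, y) + (−1)^{p} μ(x, d y) for x ∈ G̃_p, y ∈ G̃_q, where d is interpreted as 0 on G̃_0. -/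

import Mathlib

open MvPolynomial
open scoped Classical

/-- The colon ideal `(m_1,…,m_{i−1}) : m_i` of a list of monomials given by exponent
vectors `m : Fin t → (Fin n →₀ ℕ)`. -/
noncomputable def colonIdeal (k : Type) [Field k] (n t : ℕ) (m : Fin t → (Fin n →₀ ℕ))
    (i : Fin t) : Ideal (MvPolynomial (Fin n) k) :=
  Submodule.colon (Ideal.span ((fun j => monomial (m j) (1 : k)) '' {j | j < i}))
    (Ideal.span {monomial (m i) (1 : k)})

/-- The critical-index set `A_i = { j : x_j ∈ (m_1,…,m_{i−1}) : m_i }`. -/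
def critSet (k : Type) [Field k] (n t : ℕ) (m : Fin t → (Fin n →₀ ℕ)) (i : Fin t) :
    Set (Fin n) :=
  {j | (X j : MvPolynomial (Fin n) k) ∈ colonIdeal k n t m i}

/-- Index set for the basis `e_J g_i` (with `J ⊆ A_i`, `|J| = p`) of the `(p+1)`-st module
of the Eliahou–Kervaire-type complex `G̃`. -/
def EKIndex (k : Type) [Field k] (n t : ℕ) (m : Fin t → (Fin n →₀ ℕ)) (p : ℕ) : Type :=
  {q : Fin t × Finset (Fin n) // ↑q.2 ⊆ critSet k n t m q.1 ∧ q.2.card = p}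

/-- The modules of the Eliahou–Kervaire-type complex `G̃`: `G̃_0 = S` and, for `p ≥ 1`,
`G̃_p` is the free `S`-module on the symbols `e_J g_i` with `J ⊆ A_i`, `|J| = p − 1`. -/
noncomputable def EKMod (k : Type) [Field k] (n t : ℕ) (m : Fin t → (Fin n →₀ ℕ)) :
    ℕ → Type
  | 0 => MvPolynomial (Fin n) k
  | (p + 1) => EKIndex k n t m p →₀ MvPolynomial (Fin n) k

noncomputable instance (k : Type) [Field k] (n t : ℕ) (m : Fin t → (Fin n →₀ ℕ)) (p : ℕ) :
    AddCommGroup (EKMod k n t m p) := by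
  cases p with
  | zero => exact inferInstanceAs (AddCommGroup (MvPolynomial (Fin n) k))
  | succ p =>
      exact inferInstanceAs (AddCommGroup (EKIndex k n t m p →₀ MvPolynomial (Fin n) k))

noncomputable instance (k : Type) [Field k] (n t : ℕ) (m : Fin t → (Fin n →₀ ℕ)) (p : ℕ) :
    Module (MvPolynomial (Fin n) k) (EKMod k n t m p) := by
  cases p with
  | zero => exact inferInstanceAs (Module (MvPolynomial (Fin n) k) (MvPolynomial (Fin n) k))
  | succ p =>
      exact inferInstanceAs
        (Module (MvPolynomial (Fin n) k) (EKIndex k n t m p →₀ MvPolynomial (Fin n) k))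

noncomputable instance (k : Type) [Field k] (n t : ℕ) (m : Fin t → (Fin n →₀ ℕ)) (p : ℕ) :
    Module k (EKMod k n t m p) := by
  cases p with
  | zero => exact inferInstanceAs (Module k (MvPolynomial (Fin n) k))
  | succ p =>
      exact inferInstanceAs (Module k (EKIndex k n t m p →₀ MvPolynomial (Fin n) k))

/-- The basis element `e_J g_i` of `G̃_{p+1}`. -/
noncomputable def ekGen (k : Type) [Field k] (n t : ℕ) (m : Fin t → (Fin n →₀ ℕ)) {p : ℕ}
    (i : Fin t) (J : Finset (Fin n)) (h1 : ↑J ⊆ critSet k n t m i) (h2 : J.card = p) :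
    EKMod k n t m (p + 1) :=
  Finsupp.single ⟨(i, J), h1, h2⟩ 1

/-- Transport along an equality of degrees. -/
noncomputable def ekCast (k : Type) [Field k] (n t : ℕ) (m : Fin t → (Fin n →₀ ℕ))
    {p q : ℕ} (h : p = q) :
    EKMod k n t m p →ₗ[MvPolynomial (Fin n) k] EKMod k n t m q := by
  subst h; exact LinearMap.id

section Exterior

variable {R ι : Type} [CommRing R] [LinearOrder ι]

/-- The number of inversions between two finite sets: pairs `(a, b) ∈ L × M` with `b < a`. -/
def inversions (L M : Finset ι) : ℕ := ∑ a ∈ L, ∑ b ∈ M, if b < a then 1 else 0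

lemma inversions_union_left {L L' : Finset ι} (h : Disjoint L L') (M : Finset ι) :
    inversions (L ∪ L') M = inversions L M + inversions L' M :=
  Finset.sum_union h

lemma inversions_union_right (L : Finset ι) {M M' : Finset ι} (h : Disjoint M M') :
    inversions L (M ∪ M') = inversions L M + inversions L M' := by
  simp only [inversions, Finset.sum_union h, Finset.sum_add_distrib]

lemma inversions_add_swap {L M : Finset ι} (h : Disjoint L M) :
    inversions L M + inversions M L = L.card * M.card := by
  unfold inversions
  rw [Finset.sum_comm (s := M), ← Finset.sum_add_distrib, ← smul_eq_mul, ← Finset.sum_const]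
  refine Finset.sum_congr rfl fun a ha => ?_
  rw [← Finset.sum_add_distrib, Finset.card_eq_sum_ones]
  refine Finset.sum_congr rfl fun b hb => ?_
  have hab : a ≠ b := fun hab => Finset.disjoint_left.1 h ha (hab ▸ hb)
  rcases hab.lt_or_gt with h | h <;> simp [h, h.not_gt]

lemma inversions_singleton_left (r : ι) (L : Finset ι) :
    inversions {r} L = (L.filter (· < r)).card := by
  rw [inversions, Finset.sum_singleton, Finset.card_filter]

lemma inversions_erase_left {L : Finset ι} {r : ι} (hr : r ∈ L) (M : Finset ι) :
    inversions L M = inversions (L.erase r) M + inversions {r} M := by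
  rw [← inversions_union_left (by simp), Finset.union_comm, ← Finset.insert_eq,
    Finset.insert_erase hr]

lemma inversions_erase_right (L : Finset ι) {M : Finset ι} {r : ι} (hr : r ∈ M) :
    inversions L M = inversions L (M.erase r) + inversions L {r} := by
  rw [← inversions_union_right _ (by simp), Finset.union_comm, ← Finset.insert_eq,
    Finset.insert_erase hr]

lemma inversions_singleton_swap {L : Finset ι} {r : ι} (hr : r ∉ L) :
    inversions {r} L + inversions L {r} = L.card := by
  simpa using inversions_add_swap (Finset.disjoint_singleton_left.2 hr)

/-- The product of the exterior algebra on generators indexed by `ι`, in the basis of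
increasing monomials `e_L`. -/
noncomputable def extMul (R ι : Type) [CommRing R] [LinearOrder ι] :
    (Finset ι →₀ R) →ₗ[R] (Finset ι →₀ R) →ₗ[R] (Finset ι →₀ R) :=
  Finsupp.linearCombination R fun L => Finsupp.linearCombination R fun M =>
    if Disjoint L M then Finsupp.single (L ∪ M) ((-1) ^ inversions L M) else 0

lemma extMul_single (L M : Finset ι) (f g : R) :
    extMul R ι (Finsupp.single L f) (Finsupp.single M g) =
      if Disjoint L M then Finsupp.single (L ∪ M) ((-1) ^ inversions L M * (f * g)) else 0 := by
  simp only [extMul, Finsupp.linearCombination_single, LinearMap.smul_apply]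
  split_ifs
  · simp only [Finsupp.smul_single, smul_eq_mul]
    congr 1
    ring
  · simp

/-- The contraction of the exterior algebra against the `r`-th coordinate. -/
noncomputable def extContract (R : Type) {ι : Type} [CommRing R] [LinearOrder ι] (r : ι) :
    (Finset ι →₀ R) →ₗ[R] (Finset ι →₀ R) :=
  Finsupp.linearCombination R fun L =>
    if r ∈ L then Finsupp.single (L.erase r) ((-1) ^ inversions {r} L) else 0

lemma extContract_single (r : ι) (L : Finset ι) (f : R) :
    extContract R r (Finsupp.single L f) =
      if r ∈ L then Finsupp.single (L.erase r) ((-1) ^ inversions {r} L * f) else 0 := by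
  simp only [extContract, Finsupp.linearCombination_single]
  split_ifs <;> simp [mul_comm]

lemma extMul_assoc (x y z : Finset ι →₀ R) :
    extMul R ι (extMul R ι x y) z = extMul R ι x (extMul R ι y z) := by
  induction x using Finsupp.induction_linear with
  | zero => simp
  | add x x' hx hx' => simp only [map_add, LinearMap.add_apply, hx, hx']
  | single L f =>
    induction y using Finsupp.induction_linear with
    | zero => simp
    | add x x' hx hx' => simp only [map_add, LinearMap.add_apply, hx, hx']
    | single M g =>
      induction z using Finsupp.induction_linear with
      | zero => simp
      | add x x' hx hx' => simp only [map_add, hx, hx']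
      | single N h =>
        simp only [extMul_single]
        by_cases h1 : Disjoint L M
        · by_cases h2 : Disjoint M N
          · by_cases h3 : Disjoint L N
            · have e1 : Disjoint (L ∪ M) N := Finset.disjoint_union_left.2 ⟨h3, h2⟩
              have e2 : Disjoint L (M ∪ N) := Finset.disjoint_union_right.2 ⟨h1, h3⟩
              simp only [h1, h2, if_true, extMul_single, e1, e2, Finset.union_assoc,
                inversions_union_left h1, inversions_union_right _ h2]
              congr 1
              ring
            · simp only [h1, h2, if_true, extMul_single, Finset.disjoint_union_left,
                Finset.disjoint_union_right, h3, false_and, and_false, if_false]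
          · simp only [h1, h2, if_true, if_false, extMul_single, Finset.disjoint_union_left,
              and_false, map_zero]
        · by_cases h2 : Disjoint M N
          · simp only [h1, h2, if_true, if_false, extMul_single, Finset.disjoint_union_right,
              false_and, map_zero, LinearMap.zero_apply]
          · simp only [h1, h2, if_false, map_zero, LinearMap.zero_apply]

lemma extMul_single_comm (L M : Finset ι) (f g : R) :
    extMul R ι (Finsupp.single L f) (Finsupp.single M g) =
      (-1 : ℤ) ^ (L.card * M.card) • extMul R ι (Finsupp.single M g) (Finsupp.single L f) := by
  simp only [extMul_single, disjoint_comm (a := M), Finset.union_comm M]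
  split_ifs with h
  · rw [← inversions_add_swap h, Finsupp.smul_single]
    congr 1
    rw [zsmul_eq_mul]
    push_cast
    have : ((-1 : R) ^ inversions M L) * (-1) ^ inversions M L = 1 := by
      rw [← mul_pow]; simp
    linear_combination (-(-1) ^ inversions L M * f * g) * this
  · simp

lemma neg_one_pow_eq_of_add_even {a b : ℕ} (h : Even (a + b)) : (-1 : R) ^ a = (-1) ^ b := by
  rcases Nat.even_or_odd a with ha | ha
  · rw [ha.neg_one_pow, ((Nat.even_add.1 h).1 ha).neg_one_pow]
  · rw [ha.neg_one_pow,
      (Nat.not_even_iff_odd.1 fun hb =>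
        Nat.not_even_iff_odd.2 ha ((Nat.even_add.1 h).2 hb)).neg_one_pow]

lemma extContract_mul_single (r : ι) (L M : Finset ι) (f g : R) :
    extContract R r (extMul R ι (Finsupp.single L f) (Finsupp.single M g)) =
      extMul R ι (extContract R r (Finsupp.single L f)) (Finsupp.single M g) +
        (-1 : ℤ) ^ L.card •
          extMul R ι (Finsupp.single L f) (extContract R r (Finsupp.single M g)) := by
  simp only [extMul_single, extContract_single]
  by_cases hL : r ∈ L <;> by_cases hM : r ∈ M
  · have hd : ¬ Disjoint L M := fun h => Finset.disjoint_left.1 h hL hM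
    have hd' : Disjoint L (M.erase r) ↔ Disjoint (L.erase r) M := by
      rw [Finset.disjoint_erase_comm]
    simp only [hd, hL, hM, if_true, if_false, map_zero, extMul_single, hd']
    split_ifs with h
    · have hu : L ∪ M.erase r = L.erase r ∪ M := by
        ext a; by_cases ha : a = r <;> simp [ha, hL, hM]
      rw [hu, Finsupp.smul_single, ← Finsupp.single_add, eq_comm, Finsupp.single_eq_zero]
      have h1 := inversions_erase_right (L.erase r) hM
      have h2 := inversions_erase_left hL (M.erase r)
      have h3 := inversions_erase_right {r} hL
      have h3' := inversions_erase_right {r} hM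
      have h4 := inversions_singleton_swap (Finset.notMem_erase r L)
      have h5 : inversions {r} {r} = 0 := by simp [inversions]
      have h6 := Finset.card_erase_add_one hL
      rw [zsmul_eq_mul]
      push_cast
      have key : (-1 : R) ^ (inversions (L.erase r) M + inversions {r} L) =
          (-1) ^ (L.card + inversions L (M.erase r) + inversions {r} M + 1) :=
        neg_one_pow_eq_of_add_even ⟨inversions (L.erase r) (M.erase r) +
          (inversions {r} M + L.card), by omega⟩
      simp only [pow_add, pow_one] at key
      linear_combination (f * g) * key
    · simp
  · simp only [hL, hM, if_true, if_false, map_zero, smul_zero, add_zero]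
    have hd' : Disjoint (L.erase r) M ↔ Disjoint L M := by
      rw [Finset.disjoint_erase_comm, Finset.erase_eq_of_notMem hM]
    rw [extMul_single]
    simp only [hd']
    split_ifs with h
    · rw [extContract_single, if_pos (by simp [hL])]
      have hu : (L ∪ M).erase r = L.erase r ∪ M := by
        ext a; by_cases ha : a = r <;> simp [ha, hM]
      rw [hu]
      congr 1
      rw [inversions_union_right _ h, inversions_erase_left hL M]
      have : ((-1 : R) ^ inversions {r} M) * (-1) ^ inversions {r} M = 1 := by
        rw [← mul_pow]; simp
      simp only [pow_add]
      linear_combination ((-1) ^ inversions {r} L * (-1) ^ inversions (L.erase r) M * f * g) * this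
    · simp
  · simp only [hL, hM, if_true, if_false, map_zero, zero_add, LinearMap.zero_apply]
    have hd' : Disjoint L (M.erase r) ↔ Disjoint L M := by
      rw [← Finset.disjoint_erase_comm, Finset.erase_eq_of_notMem hL]
    rw [extMul_single]
    simp only [hd']
    split_ifs with h
    · rw [extContract_single, if_pos (by simp [hM])]
      have hu : (L ∪ M).erase r = L ∪ M.erase r := by
        ext a; by_cases ha : a = r <;> simp [ha, hL]
      rw [hu, Finsupp.smul_single, zsmul_eq_mul]
      congr 1
      push_cast
      have h1 := inversions_union_right {r} h
      have h2 := inversions_erase_right L hM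
      have h3 := inversions_singleton_swap hL
      have key : (-1 : R) ^ (inversions {r} (L ∪ M) + inversions L M) =
          (-1) ^ (L.card + inversions L (M.erase r) + inversions {r} M) :=
        neg_one_pow_eq_of_add_even ⟨inversions L (M.erase r) + inversions {r} M + L.card,
          by omega⟩
      simp only [pow_add] at key
      linear_combination (f * g) * key
    · simp
  · simp only [hL, hM, if_false, map_zero, smul_zero, add_zero, LinearMap.zero_apply]
    split_ifs with h
    · rw [extContract_single, if_neg (by simp [hL, hM])]
    · simp

variable [Fintype ι]

/-- The Koszul differential `e_r ↦ c r` on the exterior algebra. -/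
noncomputable def koszulD (c : ι → R) : (Finset ι →₀ R) →ₗ[R] (Finset ι →₀ R) :=
  ∑ r, c r • extContract R r

lemma koszulD_single (c : ι → R) (L : Finset ι) (f : R) :
    koszulD c (Finsupp.single L f) =
      ∑ r ∈ L, Finsupp.single (L.erase r) ((-1) ^ (L.filter (· < r)).card * (c r * f)) := by
  simp only [koszulD, LinearMap.sum_apply, LinearMap.smul_apply, extContract_single, smul_ite,
    smul_zero, Finset.sum_ite_mem, Finset.univ_inter, Finsupp.smul_single, smul_eq_mul,
    inversions_singleton_left]
  exact Finset.sum_congr rfl fun r _ => by congr 1; ring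

lemma koszulD_apply (c : ι → R) (z : Finset ι →₀ R) (L : Finset ι) :
    koszulD c z L =
      ∑ r, if r ∈ L then 0 else (-1) ^ (L.filter (· < r)).card * (c r * z (insert r L)) := by
  induction z using Finsupp.induction_linear with
  | zero => simp
  | add x y hx hy =>
    rw [map_add, Finsupp.add_apply, hx, hy, ← Finset.sum_add_distrib]
    refine Finset.sum_congr rfl fun r _ => ?_
    split_ifs
    · simp
    · rw [Finsupp.add_apply]; ring
  | single M f =>
    simp only [koszulD, LinearMap.sum_apply, LinearMap.smul_apply, Finsupp.finsetSum_apply,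
      Finsupp.smul_apply, extContract_single]
    refine Finset.sum_congr rfl fun r _ => ?_
    by_cases hL : r ∈ L
    · rw [if_pos hL]
      split_ifs
      · rw [Finsupp.single_eq_of_ne, smul_zero]
        rintro rfl
        simp at hL
      · simp
    · rw [if_neg hL]
      by_cases hM : M = insert r L
      · subst hM
        have : (insert r L).filter (· < r) = L.filter (· < r) := by
          rw [Finset.filter_insert, if_neg (lt_irrefl r)]
        simp only [Finset.mem_insert_self, if_true, Finset.erase_insert hL, Finsupp.single_eq_same,
          inversions_singleton_left, this, smul_eq_mul]
        ring
      · rw [Finsupp.single_eq_of_ne (Ne.symm hM)]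
        split_ifs with h
        · rw [Finsupp.single_eq_of_ne]
          · simp
          · rintro rfl
            exact hM (Finset.insert_erase h).symm
        · simp

lemma koszulD_mul_single (c : ι → R) (L : Finset ι) (f : R) (w : Finset ι →₀ R) :
    koszulD c (extMul R ι (Finsupp.single L f) w) =
      extMul R ι (koszulD c (Finsupp.single L f)) w +
        (-1 : ℤ) ^ L.card • extMul R ι (Finsupp.single L f) (koszulD c w) := by
  induction w using Finsupp.induction_linear with
  | zero => simp
  | add x y hx hy =>
    simp only [map_add, hx, hy, smul_add]
    abel
  | single M g =>
    simp only [koszulD, LinearMap.sum_apply, LinearMap.smul_apply, extContract_mul_single,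
      map_sum, map_smul, Finset.smul_sum, smul_add, Finset.sum_add_distrib]
    congr 1
    exact Finset.sum_congr rfl fun r _ => smul_comm _ _ _

end Exterior

section Degree

variable {R ι : Type} [CommRing R]

/-- Elements of the exterior algebra which are homogeneous of degree `p`. -/
def extDegree (R ι : Type) [CommRing R] (p : ℕ) : Submodule R (Finset ι →₀ R) :=
  Finsupp.supported R R {L | L.card = p}

lemma extDegree_induction {p : ℕ} {P : (Finset ι →₀ R) → Prop} (h0 : P 0)
    (hadd : ∀ x y, P x → P y → P (x + y))
    (hs : ∀ L f, L.card = p → P (Finsupp.single L f)) {z : Finset ι →₀ R}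
    (hz : z ∈ extDegree R ι p) : P z := by
  rw [← Finsupp.sum_single z]
  refine Finset.sum_induction _ P hadd h0 fun L hL => hs _ _ ?_
  exact (Finsupp.mem_supported R z).1 hz hL

lemma single_mem_extDegree {p : ℕ} {L : Finset ι} (h : L.card = p) (f : R) :
    Finsupp.single L f ∈ extDegree R ι p :=
  Finsupp.single_mem_supported R f h

variable [LinearOrder ι]

lemma extMul_mem_extDegree {p q : ℕ} {z w : Finset ι →₀ R} (hz : z ∈ extDegree R ι p)
    (hw : w ∈ extDegree R ι q) : extMul R ι z w ∈ extDegree R ι (p + q) := by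
  refine extDegree_induction (P := fun z => extMul R ι z w ∈ extDegree R ι (p + q)) (by simp)
    (fun x y hx hy => by simpa using add_mem hx hy) (fun L f hL => ?_) hz
  refine extDegree_induction
    (P := fun w => extMul R ι (Finsupp.single L f) w ∈ extDegree R ι (p + q)) (by simp)
    (fun x y hx hy => by simpa using add_mem hx hy) (fun M g hM => ?_) hw
  rw [extMul_single]
  split_ifs with h
  · exact single_mem_extDegree (by rw [Finset.card_union_of_disjoint h, hL, hM]) _
  · exact zero_mem _

lemma extMul_comm {p q : ℕ} {z w : Finset ι →₀ R} (hz : z ∈ extDegree R ι p)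
    (hw : w ∈ extDegree R ι q) :
    extMul R ι z w = (-1 : ℤ) ^ (p * q) • extMul R ι w z := by
  refine extDegree_induction
    (P := fun z => extMul R ι z w = (-1 : ℤ) ^ (p * q) • extMul R ι w z) (by simp)
    (fun x y hx hy => by simp only [map_add, LinearMap.add_apply, hx, hy, smul_add])
    (fun L f hL => ?_) hz
  refine extDegree_induction
    (P := fun w => extMul R ι (Finsupp.single L f) w =
      (-1 : ℤ) ^ (p * q) • extMul R ι w (Finsupp.single L f)) (by simp)
    (fun x y hx hy => by simp only [map_add, LinearMap.add_apply, hx, hy, smul_add])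
    (fun M g hM => ?_) hw
  rw [extMul_single_comm, hL, hM]

lemma koszulD_mul [Fintype ι] (c : ι → R) {p : ℕ} {z : Finset ι →₀ R}
    (hz : z ∈ extDegree R ι p) (w : Finset ι →₀ R) :
    koszulD c (extMul R ι z w) =
      extMul R ι (koszulD c z) w + (-1 : ℤ) ^ p • extMul R ι z (koszulD c w) := by
  refine extDegree_induction (P := fun z => koszulD c (extMul R ι z w) =
      extMul R ι (koszulD c z) w + (-1 : ℤ) ^ p • extMul R ι z (koszulD c w)) (by simp)
    (fun x y hx hy => ?_) (fun L f hL => by rw [← hL, koszulD_mul_single]) hz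
  simp only [map_add, LinearMap.add_apply, hx, hy, smul_add]
  abel

lemma extMul_single_empty (f : R) (w : Finset ι →₀ R) :
    extMul R ι (Finsupp.single ∅ f) w = f • w := by
  induction w using Finsupp.induction_linear with
  | zero => simp
  | add x y hx hy => simp only [map_add, hx, hy, smul_add]
  | single M g => simp [extMul_single, inversions]

end Degree

section Monomials

variable {n t : ℕ}

/-- The generator `m i` is the beginning of the monomial `γ`: it divides `γ` and all variables
of the cofactor come after those of `m i`. -/
def IsBeginning (m : Fin t → (Fin n →₀ ℕ)) (i : Fin t) (γ : Fin n →₀ ℕ) : Prop :=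
  m i ≤ γ ∧ ∀ l ∈ (γ - m i).support, ∀ b ∈ (m i).support, b ≤ l

lemma IsBeginning.eq_of_lt {m : Fin t → (Fin n →₀ ℕ)} {i : Fin t} {γ : Fin n →₀ ℕ}
    (h : IsBeginning m i γ) {l b : Fin n} (hb : b ∈ (m i).support) (hl : l < b) :
    m i l = γ l := by
  by_contra hne
  have h1 := h.1 l
  have : l ∈ (γ - m i).support := by
    rw [Finsupp.mem_support_iff, Finsupp.tsub_apply]; omega
  exact absurd (h.2 l this b hb) (not_le.2 hl)

/-- Two beginnings of the same monomial are comparable. -/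
lemma IsBeginning.le_or_le {m : Fin t → (Fin n →₀ ℕ)} {i j : Fin t} {γ : Fin n →₀ ℕ}
    (hi : IsBeginning m i γ) (hj : IsBeginning m j γ) : m i ≤ m j ∨ m j ≤ m i := by
  by_contra! h
  obtain ⟨h1, h2⟩ := h
  simp only [Finsupp.le_def, not_forall, not_le] at h1 h2
  obtain ⟨a, ha⟩ := h1
  obtain ⟨b, hb⟩ := h2
  have ha' : a ∈ (m i).support := Finsupp.mem_support_iff.2 (by omega)
  have hb' : b ∈ (m j).support := Finsupp.mem_support_iff.2 (by omega)
  rcases lt_trichotomy a b with h | h | h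
  · have := hj.eq_of_lt hb' h
    have := hi.1 a
    omega
  · subst h; omega
  · have := hi.eq_of_lt ha' h
    have := hj.1 b
    omega

lemma IsBeginning.unique {m : Fin t → (Fin n →₀ ℕ)} (hmin : ∀ i j : Fin t, i ≠ j → ¬ m i ≤ m j)
    {i j : Fin t} {γ : Fin n →₀ ℕ} (hi : IsBeginning m i γ) (hj : IsBeginning m j γ) : i = j := by
  by_contra hne
  rcases hi.le_or_le hj with h | h
  · exact hmin _ _ hne h
  · exact hmin _ _ (Ne.symm hne) h

lemma isBeginning_self (m : Fin t → (Fin n →₀ ℕ)) (i : Fin t) : IsBeginning m i (m i) :=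
  ⟨le_rfl, by simp⟩

/-- If a generator in the variables up to `c` divides `γ`, then the beginning of `γ` only involves
variables up to `c`. -/
lemma IsBeginning.le_of_dvd {m : Fin t → (Fin n →₀ ℕ)}
    (hmin : ∀ i j : Fin t, i ≠ j → ¬ m i ≤ m j) {i r : Fin t} {γ : Fin n →₀ ℕ} {c : Fin n}
    (h : IsBeginning m i γ) (hr : m r ≤ γ) (hc : ∀ b ∈ (m r).support, b ≤ c) :
    ∀ b ∈ (m i).support, b ≤ c := by
  intro b hb
  by_contra! hcb
  have hle : m r ≤ m i := fun l => by
    by_cases hl : l ∈ (m r).support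
    · rw [h.eq_of_lt hb ((hc l hl).trans_lt hcb)]; exact hr l
    · rw [Finsupp.notMem_support_iff.1 hl]; exact Nat.zero_le _
  by_cases hri : r = i
  · subst hri; exact absurd (hc b hb) (not_le.2 hcb)
  · exact hmin _ _ hri hle

lemma IsBeginning.add {m : Fin t → (Fin n →₀ ℕ)} {i : Fin t} {γ δ : Fin n →₀ ℕ}
    (h : IsBeginning m i γ) (hδ : ∀ l ∈ δ.support, ∀ b ∈ (m i).support, b ≤ l) :
    IsBeginning m i (γ + δ) := by
  refine ⟨h.1.trans (le_add_of_nonneg_right zero_le), fun l hl => ?_⟩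
  rw [tsub_add_eq_add_tsub h.1 |>.symm] at hl
  rcases Finset.mem_union.1 (Finsupp.support_add hl) with hl | hl
  · exact h.2 l hl
  · exact hδ l hl

/-- The exchange property of the generators of a stable monomial ideal. -/
def StableExchange (m : Fin t → (Fin n →₀ ℕ)) : Prop :=
  ∀ i : Fin t, ∀ b ∈ (m i).support, (∀ l ∈ (m i).support, l ≤ b) → ∀ l < b,
    ∃ r, m r ≤ m i + Finsupp.single l 1 - Finsupp.single b 1

lemma StableExchange.exists_isBeginning {m : Fin t → (Fin n →₀ ℕ)} (hst : StableExchange m)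
    {γ : Fin n →₀ ℕ} (hγ : ∃ i, m i ≤ γ) : ∃ i, IsBeginning m i γ := by
  let wt : (Fin n →₀ ℕ) → ℕ := fun α => ∑ l, α l * (l : ℕ)
  have hwt : ∀ α β : Fin n →₀ ℕ, α ≤ β → wt α ≤ wt β := fun α β h =>
    Finset.sum_le_sum fun l _ => Nat.mul_le_mul_right _ (h l)
  have hwta : ∀ α β : Fin n →₀ ℕ, wt (α + β) = wt α + wt β := fun α β => by
    simp only [wt, Finsupp.add_apply, add_mul, Finset.sum_add_distrib]
  have hwts : ∀ l : Fin n, wt (Finsupp.single l 1) = l := fun l => by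
    simp only [wt]
    rw [Finset.sum_eq_single l (fun b _ hb => by simp [Ne.symm hb])
      (by simp)]
    simp
  obtain ⟨i, hi, hmini⟩ := (Finset.univ.filter fun i => m i ≤ γ).exists_min_image
    (fun i => wt (m i)) (by obtain ⟨i, hi⟩ := hγ; exact ⟨i, by simpa using hi⟩)
  simp only [Finset.mem_filter, Finset.mem_univ, true_and] at hi hmini
  refine ⟨i, hi, fun l hl b hb => ?_⟩
  by_contra! hlb
  have hne : (m i).support.Nonempty := ⟨b, hb⟩
  set B := (m i).support.max' hne
  have hB : B ∈ (m i).support := Finset.max'_mem _ _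
  have hlB : l < B := hlb.trans_le (Finset.le_max' _ _ hb)
  obtain ⟨r, hr⟩ := hst i B hB (fun a ha => Finset.le_max' _ _ ha) l hlB
  rw [Finsupp.mem_support_iff] at hB
  rw [Finsupp.mem_support_iff, Finsupp.tsub_apply] at hl
  have hrγ : m r ≤ γ := fun a => by
    have h1 := hr a
    have h2 := hi a
    rw [Finsupp.tsub_apply, Finsupp.add_apply] at h1
    by_cases ha : a = l
    · subst ha
      rw [Finsupp.single_eq_same] at h1
      omega
    · rw [Finsupp.single_eq_of_ne ha] at h1
      omega
  have hle : Finsupp.single B 1 ≤ m i + Finsupp.single l 1 := by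
    rw [Finsupp.single_le_iff, Finsupp.add_apply]
    omega
  have h1 := hwta (m i + Finsupp.single l 1 - Finsupp.single B 1) (Finsupp.single B 1)
  rw [tsub_add_cancel_of_le hle, hwta, hwts, hwts] at h1
  have h2 := hwt _ _ hr
  have h3 := hmini r hrγ
  have h4 : (l : ℕ) < B := hlB
  omega

variable (k : Type) [Field k]

lemma mem_span_monomial {σ A : Type} [CommSemiring A] {τ : Type} (v : τ → (σ →₀ ℕ)) (s : Set τ)
    (x : MvPolynomial σ A) :
    x ∈ Ideal.span ((fun i => monomial (v i) (1 : A)) '' s) ↔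
      ∀ α ∈ x.support, ∃ i ∈ s, v i ≤ α := by
  have : (fun i => monomial (v i) (1 : A)) '' s = (fun α => monomial α (1 : A)) '' (v '' s) := by
    rw [Set.image_image]
  rw [this, mem_ideal_span_monomial_image]
  simp

lemma monomial_mem_span {σ A : Type} [CommSemiring A] [Nontrivial A] {τ : Type}
    (v : τ → (σ →₀ ℕ)) (s : Set τ) (α : σ →₀ ℕ) :
    monomial α (1 : A) ∈ Ideal.span ((fun i => monomial (v i) (1 : A)) '' s) ↔
      ∃ i ∈ s, v i ≤ α := by
  rw [mem_span_monomial]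
  simp [support_monomial]

lemma stableExchange_of_stable {m : Fin t → (Fin n →₀ ℕ)}
    (hstable : ∀ α : Fin n →₀ ℕ,
      monomial α (1 : k) ∈ Ideal.span (Set.range fun i => monomial (m i) (1 : k)) →
      ∀ b ∈ α.support, (∀ l ∈ α.support, l ≤ b) →
      ∀ i : Fin n, i < b →
        monomial (α + Finsupp.single i 1 - Finsupp.single b 1) (1 : k) ∈
          Ideal.span (Set.range fun i => monomial (m i) (1 : k))) : StableExchange m := by
  intro i b hb hmax l hl
  have := hstable (m i) (Ideal.subset_span ⟨i, rfl⟩) b hb hmax l hl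
  rw [← Set.image_univ, monomial_mem_span] at this
  simpa using this

lemma mem_critSet {m : Fin t → (Fin n →₀ ℕ)} {i : Fin t} {j : Fin n} :
    j ∈ critSet k n t m i ↔ ∃ r < i, m r ≤ m i + Finsupp.single j 1 := by
  rw [critSet, Set.mem_ofPred_eq, colonIdeal, Submodule.mem_colon]
  have : (∀ p ∈ (Ideal.span {monomial (m i) (1 : k)} : Ideal (MvPolynomial (Fin n) k)),
      (X j : MvPolynomial (Fin n) k) • p ∈
        Ideal.span ((fun j => monomial (m j) (1 : k)) '' {j | j < i})) ↔
      monomial (m i + Finsupp.single j 1) (1 : k) ∈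
        Ideal.span ((fun j => monomial (m j) (1 : k)) '' {j | j < i}) := by
    have he : monomial (m i + Finsupp.single j 1) (1 : k) = X j * monomial (m i) 1 := by
      rw [X, monomial_mul, add_comm, one_mul]
    constructor
    · intro h
      rw [he]
      exact h _ (Ideal.mem_span_singleton_self _)
    · intro h p hp
      obtain ⟨a, rfl⟩ := Ideal.mem_span_singleton.1 hp
      rw [smul_eq_mul, ← mul_assoc, ← he]
      exact Ideal.mul_mem_right _ _ h
  refine Iff.trans ?_ (this.trans ?_)
  · rfl
  · rw [monomial_mem_span]; rfl

/-- For a stable ideal with generators in decreasing lexicographic order, the critical indices of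
`m i` are those smaller than some variable of `m i`. -/
lemma mem_critSet_iff_lt {m : Fin t → (Fin n →₀ ℕ)}
    (hmin : ∀ i j : Fin t, i ≠ j → ¬ m i ≤ m j) (hst : StableExchange m)
    (hsort : ∀ i j : Fin t, i < j → toLex (m j) < toLex (m i)) {i : Fin t} {j : Fin n} :
    j ∈ critSet k n t m i ↔ ∃ b ∈ (m i).support, j < b := by
  rw [mem_critSet]
  constructor
  · rintro ⟨r, hri, hr⟩
    by_contra! hj
    obtain ⟨a, ha, hlt⟩ := hsort r i hri
    simp only [ofLex_toLex] at ha hlt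
    have h1 := hr a
    have haj : a = j := by
      by_contra haj
      rw [Finsupp.add_apply, Finsupp.single_eq_of_ne haj] at h1
      omega
    subst haj
    refine hmin i r hri.ne' fun l => ?_
    rcases lt_trichotomy l a with hl | hl | hl
    · exact (ha l hl).le
    · subst hl; exact hlt.le
    · have : m i l = 0 := by
        by_contra h0
        exact absurd (hj l (Finsupp.mem_support_iff.2 h0)) (not_le.2 hl)
      omega
  · rintro ⟨b, hb, hjb⟩
    obtain ⟨r, hr⟩ := hst.exists_isBeginning (γ := m i + Finsupp.single j 1)
      ⟨i, le_add_of_nonneg_right zero_le⟩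
    refine ⟨r, ?_, hr.1⟩
    by_contra! hir
    rcases hir.eq_or_lt with rfl | hir
    · have := hr.eq_of_lt hb hjb
      simp at this
    · obtain ⟨a, ha, hlt⟩ := hsort i r hir
      simp only [ofLex_toLex] at ha hlt
      refine hmin r i hir.ne' fun l => ?_
      rcases lt_trichotomy l a with hl | hl | hl
      · exact (ha l hl).le
      · subst hl; exact hlt.le
      · have : m r l = 0 := by
          by_contra h0
          have := hr.eq_of_lt (Finsupp.mem_support_iff.2 h0) hl
          rw [Finsupp.add_apply] at this
          omega
        omega

end Monomials

section Specialization

variable {n : ℕ} {S : Type} [CommRing S] (x : Fin n → S)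

/-- The monomial with exponent vector `α` in the elements `x`. -/
def evalMonomial (α : Fin n →₀ ℕ) : S := α.prod fun l e => x l ^ e

lemma evalMonomial_add (α β : Fin n →₀ ℕ) :
    evalMonomial x (α + β) = evalMonomial x α * evalMonomial x β :=
  Finsupp.prod_add_index' (by simp) (by simp [pow_add])

lemma evalMonomial_single (l : Fin n) : evalMonomial x (Finsupp.single l 1) = x l := by
  simp [evalMonomial]

/-- Substitution of `x l` for the `l`-th variable, for all `l ≥ a`. -/
noncomputable def specialize (a : ℕ) : MvPolynomial (Fin n) S →ₐ[S] MvPolynomial (Fin n) S :=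
  aeval fun l => if (l : ℕ) < a then X l else C (x l)

lemma specialize_X (a : ℕ) (l : Fin n) :
    specialize x a (X l) = if (l : ℕ) < a then X l else C (x l) := by
  simp [specialize]

lemma specialize_C (a : ℕ) (s : S) : specialize x a (C s) = C s :=
  (specialize x a).commutes s

lemma specialize_specialize (a b : ℕ) (f : MvPolynomial (Fin n) S) :
    specialize x a (specialize x b f) = specialize x (min a b) f := by
  have : (specialize x a).comp (specialize x b) = specialize x (min a b) := by
    ext1 l
    rw [AlgHom.comp_apply, specialize_X, specialize_X]
    split_ifs with h1 h2 h2
    · rw [specialize_X, if_pos (by omega)]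
    · rw [specialize_X, if_neg (by omega)]
    · omega
    · rw [specialize_C]
  exact DFunLike.congr_fun this f

lemma specialize_of_le {a : ℕ} (h : n ≤ a) (f : MvPolynomial (Fin n) S) :
    specialize x a f = f := by
  have : specialize x a = AlgHom.id S _ := by
    ext1 l
    rw [specialize_X, if_pos (by omega)]; rfl
  rw [this]; rfl

lemma specialize_eq_of_le {a b : ℕ} (hab : a ≤ b) {f : MvPolynomial (Fin n) S}
    (h : specialize x a f = f) : specialize x b f = f := by
  rw [← h, specialize_specialize, min_eq_right hab]

lemma specialize_monomial {a : ℕ} {α : Fin n →₀ ℕ} (h : ∀ l ∈ α.support, (l : ℕ) < a) :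
    specialize x a (monomial α 1) = monomial α 1 := by
  rw [monomial_eq, map_mul, specialize_C, map_finsuppProd]
  congr 1
  refine Finset.prod_congr rfl fun l hl => ?_
  simp only [map_pow, specialize_X, if_pos (h l hl)]

lemma specialize_zero_monomial (α : Fin n →₀ ℕ) :
    specialize x 0 (monomial α 1) = C (evalMonomial x α) := by
  rw [monomial_eq, map_mul, specialize_C, map_finsuppProd, evalMonomial, map_finsuppProd, C_1,
    one_mul]
  refine Finset.prod_congr rfl fun l hl => ?_
  simp only [map_pow, specialize_X, Nat.not_lt_zero, if_false]

/-- The coefficients of the Koszul differential: `x i - y i` for `i < n`, and `1` for the extra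
last generator. -/
noncomputable def koszulCoeff (i : Fin (n + 1)) : MvPolynomial (Fin n) S :=
  if h : (i : ℕ) < n then C (x ⟨i, h⟩) - X ⟨i, h⟩ else 1

lemma koszulCoeff_castSucc (c : Fin n) : koszulCoeff x c.castSucc = C (x c) - X c := by
  simp [koszulCoeff]

lemma koszulCoeff_last : koszulCoeff x (Fin.last n) = 1 := by
  simp [koszulCoeff]

lemma koszulCoeff_ne_zero [Nontrivial S] (i : Fin (n + 1)) : koszulCoeff x i ≠ 0 := by
  unfold koszulCoeff
  split_ifs with h
  · intro h0
    have := congrArg (coeff (Finsupp.single (⟨i, h⟩ : Fin n) 1)) h0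
    rw [coeff_sub, coeff_C, if_neg (by simp [eq_comm]), coeff_X] at this
    simp at this
  · exact one_ne_zero

lemma specialize_koszulCoeff_of_le {a : ℕ} {i : Fin (n + 1)} (hi : (i : ℕ) < n) (h : a ≤ i) :
    specialize x a (koszulCoeff x i) = 0 := by
  rw [koszulCoeff, dif_pos hi, map_sub, specialize_C, specialize_X, if_neg (by simpa using h),
    sub_self]

lemma specialize_koszulCoeff_of_lt {a : ℕ} {i : Fin (n + 1)} (h : (i : ℕ) < a) :
    specialize x a (koszulCoeff x i) = koszulCoeff x i := by
  unfold koszulCoeff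
  split_ifs with hi
  · rw [map_sub, specialize_C, specialize_X, if_pos h]
  · rw [map_one]

/-- The substitution `specialize x a` for `a ≤ n`, and `0` beyond. -/
noncomputable def truncSpecialize (a : ℕ) : MvPolynomial (Fin n) S →ₗ[S] MvPolynomial (Fin n) S :=
  if a ≤ n then (specialize x a).toLinearMap else 0

lemma truncSpecialize_of_le {a : ℕ} (h : a ≤ n) (f : MvPolynomial (Fin n) S) :
    truncSpecialize x a f = specialize x a f := by
  rw [truncSpecialize, if_pos h]; rfl

lemma truncSpecialize_succ : truncSpecialize x (n + 1) = 0 := by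
  rw [truncSpecialize, if_neg (by omega)]

lemma truncSpecialize_mul {a b : ℕ} (hab : a ≤ b) {f : MvPolynomial (Fin n) S}
    (hf : specialize x a f = f) (g : MvPolynomial (Fin n) S) :
    truncSpecialize x b (f * g) = f * truncSpecialize x b g := by
  unfold truncSpecialize
  split_ifs with h
  · simp [specialize_eq_of_le x hab hf]
  · simp

lemma koszulCoeff_dvd (i : Fin (n + 1)) (f : MvPolynomial (Fin n) S) :
    koszulCoeff x i ∣ truncSpecialize x i f - truncSpecialize x (i + 1) f := by
  by_cases hi : (i : ℕ) < n
  · rw [truncSpecialize_of_le x hi.le, truncSpecialize_of_le x hi]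
    induction f using MvPolynomial.induction_on with
    | C s => simp
    | add p q hp hq =>
      rw [map_add, map_add, add_sub_add_comm]
      exact dvd_add hp hq
    | mul_X p l hp =>
      have : specialize x i (p * X l) - specialize x (i + 1) (p * X l) =
          (specialize x i p - specialize x (i + 1) p) * specialize x i (X l) +
            specialize x (i + 1) p * (specialize x i (X l) - specialize x (i + 1) (X l)) := by
        simp only [map_mul]; ring
      rw [this]
      refine dvd_add (hp.mul_right _) (Dvd.dvd.mul_left ?_ _)
      rw [specialize_X, specialize_X]
      split_ifs with h1 h2 h2
      · simp
      · omega
      · have hl : l = ⟨i, hi⟩ := Fin.ext (by simp; omega)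
        rw [koszulCoeff, dif_pos hi, hl]
      · simp
  · rw [koszulCoeff, dif_neg hi]
    exact one_dvd _

section Domain

variable [IsDomain S]

/-- The divided difference of a polynomial between two consecutive substitutions. -/
noncomputable def dividedDiff (i : Fin (n + 1)) :
    MvPolynomial (Fin n) S →ₗ[S] MvPolynomial (Fin n) S where
  toFun f := (koszulCoeff_dvd x i f).choose
  map_add' f g := mul_left_cancel₀ (koszulCoeff_ne_zero x i) <| by
    rw [mul_add, ← (koszulCoeff_dvd x i _).choose_spec, ← (koszulCoeff_dvd x i _).choose_spec,
      ← (koszulCoeff_dvd x i _).choose_spec, map_add, map_add]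
    ring
  map_smul' s f := mul_left_cancel₀ (koszulCoeff_ne_zero x i) <| by
    rw [RingHom.id_apply, mul_smul_comm, ← (koszulCoeff_dvd x i _).choose_spec,
      ← (koszulCoeff_dvd x i _).choose_spec, map_smul, map_smul, smul_sub]

lemma koszulCoeff_mul_dividedDiff (i : Fin (n + 1)) (f : MvPolynomial (Fin n) S) :
    koszulCoeff x i * dividedDiff x i f = truncSpecialize x i f - truncSpecialize x (i + 1) f :=
  (koszulCoeff_dvd x i f).choose_spec.symm

lemma dividedDiff_eq {i : Fin (n + 1)} {f g : MvPolynomial (Fin n) S}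
    (h : koszulCoeff x i * g = truncSpecialize x i f - truncSpecialize x (i + 1) f) :
    dividedDiff x i f = g :=
  mul_left_cancel₀ (koszulCoeff_ne_zero x i) (by rw [koszulCoeff_mul_dividedDiff, h])

lemma dividedDiff_last (f : MvPolynomial (Fin n) S) : dividedDiff x (Fin.last n) f = f :=
  dividedDiff_eq x <| by
    rw [Fin.val_last, truncSpecialize_succ, truncSpecialize_of_le x le_rfl,
      specialize_of_le x le_rfl, koszulCoeff_last]
    simp

lemma dividedDiff_mul {i : Fin (n + 1)} {f : MvPolynomial (Fin n) S}
    (hf : specialize x i f = f) (g : MvPolynomial (Fin n) S) :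
    dividedDiff x i (f * g) = f * dividedDiff x i g :=
  dividedDiff_eq x <| by
    rw [mul_left_comm, koszulCoeff_mul_dividedDiff, truncSpecialize_mul x le_rfl hf,
      truncSpecialize_mul x (Nat.le_succ _) hf, mul_sub]

lemma specialize_dividedDiff (i : Fin (n + 1)) (f : MvPolynomial (Fin n) S) :
    specialize x (i + 1) (dividedDiff x i f) = dividedDiff x i f := by
  by_cases hi : (i : ℕ) < n
  · refine (dividedDiff_eq x ?_).symm
    rw [← specialize_koszulCoeff_of_lt x (Nat.lt_succ_self i), Nat.succ_eq_add_one, ← map_mul,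
      koszulCoeff_mul_dividedDiff, truncSpecialize_of_le x hi.le, truncSpecialize_of_le x hi,
      map_sub, specialize_specialize, specialize_specialize]
    simp
  · rw [specialize_of_le x (by omega)]

lemma dividedDiff_koszulCoeff_of_lt {i r : Fin (n + 1)} (hr : (r : ℕ) < n) (h : i < r)
    (f : MvPolynomial (Fin n) S) : dividedDiff x i (koszulCoeff x r * f) = 0 :=
  dividedDiff_eq x <| by
    have h' : (i : ℕ) < r := h
    rw [truncSpecialize_of_le x (by omega), truncSpecialize_of_le x (by omega), map_mul, map_mul,
      specialize_koszulCoeff_of_le x hr (by omega), specialize_koszulCoeff_of_le x hr (by omega)]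
    simp

lemma dividedDiff_koszulCoeff_self {i : Fin (n + 1)} (hi : (i : ℕ) < n)
    (f : MvPolynomial (Fin n) S) :
    dividedDiff x i (koszulCoeff x i * f) = - truncSpecialize x (i + 1) f :=
  dividedDiff_eq x <| by
    rw [truncSpecialize_of_le x hi.le, truncSpecialize_of_le x hi, truncSpecialize_of_le x hi,
      map_mul, map_mul, specialize_koszulCoeff_of_le x hi le_rfl,
      specialize_koszulCoeff_of_lt x (Nat.lt_succ_self i)]
    ring

lemma dividedDiff_koszulCoeff_of_gt {i r : Fin (n + 1)} (h : r < i)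
    (f : MvPolynomial (Fin n) S) :
    dividedDiff x i (koszulCoeff x r * f) = koszulCoeff x r * dividedDiff x i f :=
  dividedDiff_mul x (specialize_koszulCoeff_of_lt x h) f

end Domain

end Specialization

section Ideals

variable {n t : ℕ} {S : Type} [CommRing S] (x : Fin n → S) (m : Fin t → (Fin n →₀ ℕ))

lemma linearMap_mem_of_mem_span {M : Type} [AddCommGroup M] [Module S M]
    (φ : MvPolynomial (Fin n) S →ₗ[S] M) (T : Submodule S M) {G : Set (MvPolynomial (Fin n) S)}
    (h : ∀ β, ∀ g ∈ G, φ (monomial β 1 * g) ∈ T) {f : MvPolynomial (Fin n) S}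
    (hf : f ∈ Ideal.span G) : φ f ∈ T := by
  suffices H : ∀ β, φ (monomial β 1 * f) ∈ T by simpa using H 0
  induction hf using Submodule.span_induction with
  | mem g hg => exact fun β => h β g hg
  | zero => simp
  | add f g _ _ hf hg =>
    intro β
    rw [mul_add, map_add]
    exact add_mem (hf β) (hg β)
  | smul a f _ hf =>
    intro β
    rw [smul_eq_mul]
    induction a using MvPolynomial.induction_on' with
    | monomial γ s =>
      have : monomial β 1 * (monomial γ s * f) = s • (monomial (β + γ) 1 * f) := by
        rw [← mul_assoc, monomial_mul, one_mul, ← smul_mul_assoc, smul_monomial, smul_eq_mul,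
          mul_one]
      rw [this, map_smul]
      exact T.smul_mem _ (hf _)
    | add p q hp hq =>
      rw [add_mul, mul_add, map_add]
      exact add_mem hp hq

/-- The `S`-linear map sending a monomial with beginning `m i` to its cofactor evaluated at `x`,
and all other monomials to zero. -/
noncomputable def beginningCoeff (i : Fin t) : MvPolynomial (Fin n) S →ₗ[S] S :=
  (basisMonomials (Fin n) S).constr S fun α =>
    if IsBeginning m i α then evalMonomial x (α - m i) else 0

lemma beginningCoeff_monomial (i : Fin t) (α : Fin n →₀ ℕ) :
    beginningCoeff x m i (monomial α 1) =
      if IsBeginning m i α then evalMonomial x (α - m i) else 0 := by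
  have := (basisMonomials (Fin n) S).constr_basis S
    (fun α => if IsBeginning m i α then evalMonomial x (α - m i) else 0) α
  rwa [coe_basisMonomials] at this

/-- The monomial ideal generated by the `m i`, in the variables `y`. -/
noncomputable def monomialIdeal (S : Type) [CommRing S] (m : Fin t → (Fin n →₀ ℕ)) :
    Ideal (MvPolynomial (Fin n) S) :=
  Ideal.span (Set.range fun i => monomial (m i) 1)

/-- The coefficient ideal at `e_L` of the differential ideal generated by the elements
`(x c - y c) m_r` and `e_c m_r`, where `m_r` involves only variables up to `c`. -/
noncomputable def nullIdeal (L : Finset (Fin (n + 1))) : Ideal (MvPolynomial (Fin n) S) :=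
  Ideal.span
    ({f | ∃ (c : Fin n) (r : Fin t), (∀ b ∈ (m r).support, b ≤ c) ∧
        f = koszulCoeff x c.castSucc * monomial (m r) 1} ∪
      {f | ∃ (c : Fin n) (r : Fin t), (∀ b ∈ (m r).support, b ≤ c) ∧ c.castSucc ∈ L ∧
        f = monomial (m r) 1})

lemma koszulCoeff_mul_mem_nullIdeal {c : Fin n} {r : Fin t} (h : ∀ b ∈ (m r).support, b ≤ c)
    (L : Finset (Fin (n + 1))) :
    koszulCoeff x c.castSucc * monomial (m r) 1 ∈ nullIdeal x m L :=
  Ideal.subset_span (Or.inl ⟨c, r, h, rfl⟩)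

lemma monomial_mem_nullIdeal {c : Fin n} {r : Fin t} (h : ∀ b ∈ (m r).support, b ≤ c)
    {L : Finset (Fin (n + 1))} (hc : c.castSucc ∈ L) :
    monomial (m r) 1 ∈ nullIdeal x m L :=
  Ideal.subset_span (Or.inr ⟨c, r, h, hc, rfl⟩)

lemma nullIdeal_mono {L L' : Finset (Fin (n + 1))} (h : L ⊆ L') :
    nullIdeal x m L ≤ nullIdeal x m L' := by
  refine Ideal.span_le.2 ?_
  rintro f (⟨c, r, hr, rfl⟩ | ⟨c, r, hr, hc, rfl⟩)
  · exact koszulCoeff_mul_mem_nullIdeal x m hr L'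
  · exact monomial_mem_nullIdeal x m hr (h hc)

lemma koszulCoeff_mul_mem_nullIdeal_erase {L : Finset (Fin (n + 1))} (r : Fin (n + 1))
    {f : MvPolynomial (Fin n) S} (hf : f ∈ nullIdeal x m L) :
    koszulCoeff x r * f ∈ nullIdeal x m (L.erase r) := by
  suffices H : nullIdeal x m L ≤
      Submodule.comap (LinearMap.mulLeft (MvPolynomial (Fin n) S) (koszulCoeff x r))
        (nullIdeal x m (L.erase r)) from H hf
  refine Ideal.span_le.2 ?_
  rintro f (⟨c, r', hr', rfl⟩ | ⟨c, r', hr', hc, rfl⟩)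
  all_goals rw [SetLike.mem_coe, Submodule.mem_comap, LinearMap.mulLeft_apply]
  · exact Ideal.mul_mem_left _ _ (koszulCoeff_mul_mem_nullIdeal x m hr' _)
  · by_cases h : c.castSucc = r
    · subst h
      exact koszulCoeff_mul_mem_nullIdeal x m hr' _
    · exact Ideal.mul_mem_left _ _
        (monomial_mem_nullIdeal x m hr' (Finset.mem_erase.2 ⟨h, hc⟩))

lemma specialize_zero_of_mem_nullIdeal {f : MvPolynomial (Fin n) S}
    (hf : f ∈ nullIdeal x m ∅) : specialize x 0 f = 0 := by
  suffices H : nullIdeal x m ∅ ≤ RingHom.ker (specialize x 0) from H hf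
  refine Ideal.span_le.2 ?_
  rintro f (⟨c, r, hr, rfl⟩ | ⟨c, r, hr, hc, rfl⟩)
  · rw [SetLike.mem_coe, RingHom.mem_ker, map_mul,
      specialize_koszulCoeff_of_le x (by simp) (Nat.zero_le _), zero_mul]
  · simp at hc

/-- All indices in `L` other than the last one are smaller than some variable of `m i`. -/
def IsCritical (L : Finset (Fin (n + 1))) (i : Fin t) : Prop :=
  ∀ c : Fin n, c.castSucc ∈ L → ∃ b ∈ (m i).support, c < b

variable {m}

lemma beginningCoeff_of_mem_nullIdeal (hmin : ∀ i j : Fin t, i ≠ j → ¬ m i ≤ m j)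
    (hst : StableExchange m) {L : Finset (Fin (n + 1))} {i : Fin t} (hL : IsCritical m L i)
    {f : MvPolynomial (Fin n) S} (hf : f ∈ nullIdeal x m L) : beginningCoeff x m i f = 0 := by
  rw [← Submodule.mem_bot S]
  refine linearMap_mem_of_mem_span _ _ ?_ hf
  rintro β f (⟨c, r, hr, rfl⟩ | ⟨c, r, hr, hc, rfl⟩)
  · have hle : m r ≤ β + m r := le_add_of_nonneg_left zero_le
    have he : monomial β (1 : S) * (koszulCoeff x c.castSucc * monomial (m r) 1) =
        x c • monomial (β + m r) 1 - monomial (β + m r + Finsupp.single c 1) 1 := by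
      have h1 : (monomial (β + m r + Finsupp.single c 1) 1 : MvPolynomial (Fin n) S) =
          monomial β 1 * monomial (m r) 1 * X c := by
        rw [X, monomial_mul, monomial_mul]; simp
      have h2 : (monomial (β + m r) 1 : MvPolynomial (Fin n) S) =
          monomial β 1 * monomial (m r) 1 := by
        rw [monomial_mul]; simp
      rw [h1, h2, koszulCoeff_castSucc, smul_eq_C_mul]
      ring
    rw [Submodule.mem_bot, he, map_sub, map_smul, beginningCoeff_monomial,
      beginningCoeff_monomial]
    have hfwd : ∀ j, IsBeginning m j (β + m r) →
        IsBeginning m j (β + m r + Finsupp.single c 1) := fun j hj => hj.add fun l hl b hb => by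
      rw [Finset.mem_singleton.1 (Finsupp.support_single_subset hl)]
      exact hj.le_of_dvd hmin hle hr b hb
    have hiff : IsBeginning m i (β + m r + Finsupp.single c 1) ↔ IsBeginning m i (β + m r) := by
      refine ⟨fun h => ?_, hfwd i⟩
      obtain ⟨j, hj⟩ := hst.exists_isBeginning ⟨r, hle⟩
      rwa [h.unique hmin (hfwd j hj)]
    rw [hiff]
    split_ifs with h
    · rw [← tsub_add_eq_add_tsub h.1, evalMonomial_add, evalMonomial_single, smul_eq_mul]
      ring
    · simp
  · rw [Submodule.mem_bot, monomial_mul, one_mul, beginningCoeff_monomial, if_neg]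
    intro h
    obtain ⟨b, hb, hcb⟩ := hL c hc
    exact absurd (h.le_of_dvd hmin (le_add_of_nonneg_left zero_le) hr b hb)
      (not_le.2 hcb)

lemma monomial_sub_mem_nullIdeal (L : Finset (Fin (n + 1))) (i : Fin t) (v : Fin n →₀ ℕ)
    (hv : ∀ l ∈ v.support, ∀ b ∈ (m i).support, b ≤ l) :
    monomial (v + m i) 1 - C (evalMonomial x v) * monomial (m i) 1 ∈ nullIdeal x m L := by
  induction hd : v.degree generalizing v with
  | zero =>
    rw [(Finsupp.degree_eq_zero_iff v).1 hd]
    simp [evalMonomial]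
  | succ d ih =>
    have hne : v ≠ 0 := by rintro rfl; simp at hd
    obtain ⟨l, hl⟩ := Finsupp.support_nonempty_iff.2 hne
    have hle : Finsupp.single l 1 ≤ v := by
      rw [Finsupp.single_le_iff]
      exact Nat.one_le_iff_ne_zero.2 (Finsupp.mem_support_iff.1 hl)
    obtain ⟨w, rfl⟩ := exists_add_of_le hle
    have h1 := ih w (fun a ha => hv a (by
        rw [Finsupp.mem_support_iff] at ha ⊢
        rw [Finsupp.add_apply]; omega)) (by
      rw [map_add, Finsupp.degree_single] at hd; omega)
    have h2 : (monomial (Finsupp.single l 1 + w + m i) 1 : MvPolynomial (Fin n) S) =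
        X l * monomial (w + m i) 1 := by
      rw [X, monomial_mul, one_mul, add_assoc]
    have h4 : (monomial (w + m i) 1 : MvPolynomial (Fin n) S) =
        monomial w 1 * monomial (m i) 1 := by
      rw [monomial_mul, one_mul]
    have h3 : X l * monomial (w + m i) 1 - C (x l * evalMonomial x w) * monomial (m i) 1 =
        C (x l) * (monomial (w + m i) 1 - C (evalMonomial x w) * monomial (m i) 1) -
          monomial w 1 * (koszulCoeff x l.castSucc * monomial (m i) 1) := by
      rw [koszulCoeff_castSucc, C_mul, h4]
      ring
    rw [h2, evalMonomial_add, evalMonomial_single, h3]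
    exact sub_mem (Ideal.mul_mem_left _ _ h1)
      (Ideal.mul_mem_left _ _ (koszulCoeff_mul_mem_nullIdeal x m (hv l hl) L))

/-- Modulo `nullIdeal`, an element of the monomial ideal is determined by its beginning
coefficients. -/
lemma sub_sum_mem_nullIdeal (hmin : ∀ i j : Fin t, i ≠ j → ¬ m i ≤ m j)
    (hst : StableExchange m) (L : Finset (Fin (n + 1))) {f : MvPolynomial (Fin n) S}
    (hf : f ∈ monomialIdeal S m) :
    f - ∑ i, (if IsCritical m L i then
      C (beginningCoeff x m i f) * monomial (m i) 1 else 0) ∈ nullIdeal x m L := by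
  let φ : MvPolynomial (Fin n) S →ₗ[S] MvPolynomial (Fin n) S :=
    LinearMap.id - ∑ i, if IsCritical m L i then
      (LinearMap.toSpanSingleton S _ (monomial (m i) 1)) ∘ₗ (beginningCoeff x m i) else 0
  have hφ : ∀ g, φ g = g - ∑ i, (if IsCritical m L i then
      C (beginningCoeff x m i g) * monomial (m i) 1 else 0) := fun g => by
    simp only [φ, LinearMap.sub_apply, LinearMap.id_apply, LinearMap.sum_apply]
    congr 1
    refine Finset.sum_congr rfl fun i _ => ?_
    split_ifs
    · rw [LinearMap.comp_apply, LinearMap.toSpanSingleton_apply, smul_eq_C_mul]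
    · rfl
  rw [← hφ]
  refine linearMap_mem_of_mem_span φ ((nullIdeal x m L).restrictScalars S) ?_ hf
  rintro β _ ⟨r, rfl⟩
  rw [Submodule.restrictScalars_mem, monomial_mul, one_mul, hφ]
  obtain ⟨i, hi⟩ := hst.exists_isBeginning ⟨r, le_add_of_nonneg_left (b := β) zero_le⟩
  rw [Finset.sum_eq_single i (fun j _ hj => ?_) (by simp), beginningCoeff_monomial, if_pos hi]
  · have h1 := monomial_sub_mem_nullIdeal x L i _ hi.2
    rw [tsub_add_cancel_of_le hi.1] at h1
    split_ifs with hc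
    · exact h1
    · rw [sub_zero, ← sub_add_cancel (monomial (β + m r) 1) (C (evalMonomial x (β + m r - m i)) *
        monomial (m i) 1)]
      refine add_mem h1 (Ideal.mul_mem_left _ _ ?_)
      simp only [IsCritical, not_forall, not_exists, not_and, not_lt] at hc
      obtain ⟨c, hcL, hc⟩ := hc
      exact monomial_mem_nullIdeal x m hc hcL
  · have hn : ¬ IsBeginning m j (β + m r) := fun h => hj (h.unique hmin hi)
    simp [beginningCoeff_monomial, hn]

/-- The smallest bound of the elements of `L`. -/
def height (L : Finset (Fin (n + 1))) : ℕ := L.sup fun i => (i : ℕ) + 1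

lemma lt_height {L : Finset (Fin (n + 1))} {i : Fin (n + 1)} (h : i ∈ L) : (i : ℕ) < height L :=
  Finset.le_sup (f := fun i : Fin (n + 1) => (i : ℕ) + 1) h

lemma height_le_iff {L : Finset (Fin (n + 1))} {a : ℕ} :
    height L ≤ a ↔ ∀ i ∈ L, (i : ℕ) < a :=
  Finset.sup_le_iff

lemma dividedDiff_mem_nullIdeal [IsDomain S] {L : Finset (Fin (n + 1))} {i : Fin (n + 1)}
    (hi : height L ≤ i) {f : MvPolynomial (Fin n) S} (hf : f ∈ nullIdeal x m L) :
    dividedDiff x i f ∈ nullIdeal x m (insert i L) := by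
  refine linearMap_mem_of_mem_span (dividedDiff x i)
    ((nullIdeal x m (insert i L)).restrictScalars S) ?_ hf
  have key : ∀ (a : ℕ) (c : Fin n) (r : Fin t), (c : ℕ) < a → (∀ b ∈ (m r).support, b ≤ c) →
      specialize x a (monomial (m r) 1) = monomial (m r) 1 := fun a c r hca hr =>
    specialize_monomial x fun l hl => lt_of_le_of_lt (hr l hl) hca
  rintro β f (⟨c, r, hr, rfl⟩ | ⟨c, r, hr, hc, rfl⟩)
  · rw [Submodule.restrictScalars_mem, mul_left_comm]
    rcases lt_trichotomy c.castSucc i with h | rfl | h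
    · rw [dividedDiff_koszulCoeff_of_gt x h, mul_comm (monomial β 1),
        dividedDiff_mul x (key i c r h hr), ← mul_assoc]
      exact Ideal.mul_mem_right _ _ (koszulCoeff_mul_mem_nullIdeal x m hr _)
    · rw [dividedDiff_koszulCoeff_self x (by simp), mul_comm (monomial β 1),
        truncSpecialize_mul x le_rfl (key _ c r (by simp) hr)]
      exact neg_mem (Ideal.mul_mem_right _ _
        (monomial_mem_nullIdeal x m hr (Finset.mem_insert_self _ _)))
    · rw [dividedDiff_koszulCoeff_of_lt x (by simp) h]
      exact zero_mem _
  · rw [Submodule.restrictScalars_mem, mul_comm,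
      dividedDiff_mul x (key i c r (height_le_iff.1 hi _ hc) hr)]
    exact Ideal.mul_mem_right _ _
      (monomial_mem_nullIdeal x m hr (Finset.mem_insert_of_mem hc))

end Ideals

section CoefficientSubgroup

variable {R ι : Type} [CommRing R]

/-- The elements of the exterior algebra whose coefficient at `e_L` lies in `P L`. -/
def coefSubgroup (P : Finset ι → AddSubgroup R) : AddSubgroup (Finset ι →₀ R) where
  carrier := {z | ∀ L, z L ∈ P L}
  zero_mem' _ := zero_mem _
  add_mem' hx hy L := add_mem (hx L) (hy L)
  neg_mem' hx L := neg_mem (hx L)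

lemma single_mem_coefSubgroup {P : Finset ι → AddSubgroup R} {L : Finset ι} {f : R}
    (h : f ∈ P L) : Finsupp.single L f ∈ coefSubgroup P := by
  intro M
  rw [Finsupp.single_apply]
  split_ifs with hM
  · rwa [← hM]
  · exact zero_mem _

lemma map_mem_of_mem_coefSubgroup {M : Type} [AddCommGroup M] (φ : (Finset ι →₀ R) →+ M)
    {P : Finset ι → AddSubgroup R} {T : AddSubgroup M}
    (h : ∀ L, ∀ f ∈ P L, φ (Finsupp.single L f) ∈ T) {z : Finset ι →₀ R}
    (hz : z ∈ coefSubgroup P) : φ z ∈ T := by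
  rw [← Finsupp.sum_single z, Finsupp.sum, map_sum]
  exact sum_mem fun L _ => h L _ (hz L)

lemma extMul_mem_coefSubgroup [LinearOrder ι] {P P' P'' : Finset ι → AddSubgroup R}
    (h : ∀ L M, Disjoint L M → ∀ f ∈ P L, ∀ g ∈ P' M, f * g ∈ P'' (L ∪ M))
    {z w : Finset ι →₀ R} (hz : z ∈ coefSubgroup P) (hw : w ∈ coefSubgroup P') :
    extMul R ι z w ∈ coefSubgroup P'' := by
  refine map_mem_of_mem_coefSubgroup ((extMul R ι).flip w).toAddMonoidHom (fun L f hf => ?_) hz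
  refine map_mem_of_mem_coefSubgroup (extMul R ι (Finsupp.single L f)).toAddMonoidHom
    (fun M g hg => ?_) hw
  rw [LinearMap.toAddMonoidHom_coe, extMul_single]
  split_ifs with hd
  · refine single_mem_coefSubgroup ?_
    rcases neg_one_pow_eq_or R (inversions L M) with h1 | h1 <;> rw [h1]
    · simpa using h L M hd f hf g hg
    · simpa using h L M hd f hf g hg
  · exact zero_mem _

lemma koszulD_mem_coefSubgroup [LinearOrder ι] [Fintype ι] {c : ι → R}
    {P P' : Finset ι → AddSubgroup R}
    (h : ∀ L, ∀ r ∈ L, ∀ f ∈ P L, c r * f ∈ P' (L.erase r))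
    {z : Finset ι →₀ R} (hz : z ∈ coefSubgroup P) : koszulD c z ∈ coefSubgroup P' := by
  refine map_mem_of_mem_coefSubgroup (koszulD c).toAddMonoidHom (fun L f hf => ?_) hz
  rw [LinearMap.toAddMonoidHom_coe, koszulD_single]
  refine sum_mem fun r hr => single_mem_coefSubgroup ?_
  rcases neg_one_pow_eq_or R (L.filter (· < r)).card with h1 | h1 <;> rw [h1]
  · simpa using h L r hr f hf
  · simpa using h L r hr f hf

lemma koszulD_mem_extDegree [LinearOrder ι] [Fintype ι] (c : ι → R) {p : ℕ}
    {z : Finset ι →₀ R} (hz : z ∈ extDegree R ι (p + 1)) : koszulD c z ∈ extDegree R ι p := by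
  refine extDegree_induction (P := fun z => koszulD c z ∈ extDegree R ι p) (by simp)
    (fun x y hx hy => by simpa using add_mem hx hy) (fun L f hL => ?_) hz
  rw [koszulD_single]
  refine sum_mem fun r hr => single_mem_extDegree ?_ _
  rw [Finset.card_erase_of_mem hr, hL, Nat.add_sub_cancel]

end CoefficientSubgroup

section Telescope

lemma sum_filter_le_sub {M : Type} [AddCommGroup M] {n h : ℕ} (hn : h ≤ n) (T : ℕ → M) :
    ∑ i ∈ Finset.univ.filter (fun i : Fin n => h ≤ i), (T i - T (i + 1)) =
      T h - T n := by
  rw [Finset.sum_filter]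
  rw [Fin.sum_univ_eq_sum_range (fun i => if h ≤ i then T i - T (i + 1) else 0) n]
  induction n, hn using Nat.le_induction with
  | base =>
    rw [sub_self]
    exact Finset.sum_eq_zero fun i hi => if_neg (not_le.2 (Finset.mem_range.1 hi))
  | succ n hn ih =>
    rw [Finset.sum_range_succ, ih, if_pos hn]
    abel

end Telescope

section Homotopy

variable {n : ℕ} {S : Type} [CommRing S] [IsDomain S] (x : Fin n → S)

/-- The contracting homotopy of the Koszul complex of the `x i - y i`. -/
noncomputable def homotopy : (Finset (Fin (n + 1)) →₀ MvPolynomial (Fin n) S) →ₗ[S]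
    (Finset (Fin (n + 1)) →₀ MvPolynomial (Fin n) S) :=
  Finsupp.lsum S fun L => ∑ i ∈ Finset.univ.filter (fun i : Fin (n + 1) => height L ≤ i),
    Finsupp.lsingle (insert i L) ∘ₗ dividedDiff x i

lemma homotopy_single (L : Finset (Fin (n + 1))) (f : MvPolynomial (Fin n) S) :
    homotopy x (Finsupp.single L f) =
      ∑ i ∈ Finset.univ.filter (fun i : Fin (n + 1) => height L ≤ i),
        Finsupp.single (insert i L) (dividedDiff x i f) := by
  rw [homotopy, Finsupp.lsum_single, LinearMap.sum_apply]
  rfl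

lemma notMem_of_height_le {L : Finset (Fin (n + 1))} {i : Fin (n + 1)} (h : height L ≤ i) :
    i ∉ L := fun hi => absurd (lt_height hi) (not_lt.2 h)

lemma dividedDiff_neg_one_pow_mul (i : Fin (n + 1)) (a : ℕ) (f : MvPolynomial (Fin n) S) :
    dividedDiff x i ((-1) ^ a * f) = (-1) ^ a * dividedDiff x i f :=
  dividedDiff_mul x (by simp) f

lemma sum_koszulCoeff_mul_dividedDiff {h : ℕ} (hn : h ≤ n) (f : MvPolynomial (Fin n) S) :
    ∑ i ∈ Finset.univ.filter (fun i : Fin (n + 1) => h ≤ i),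
      koszulCoeff x i * dividedDiff x i f = specialize x h f := by
  simp only [koszulCoeff_mul_dividedDiff]
  rw [sum_filter_le_sub (by omega) (fun a => truncSpecialize x a f), truncSpecialize_succ,
    truncSpecialize_of_le x hn, LinearMap.zero_apply, sub_zero]

lemma height_le_of_last_notMem {L : Finset (Fin (n + 1))} (h : Fin.last n ∉ L) :
    height L ≤ n := height_le_iff.2 fun i hi => by
  have := i.2
  have h2 : (i : ℕ) ≠ n := fun h3 => h (by
    have : i = Fin.last n := Fin.ext h3
    rwa [← this])
  omega

lemma koszulD_homotopy_single_aux {J : Finset (Fin (n + 1))} (hJ : Fin.last n ∉ J)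
    (f : MvPolynomial (Fin n) S) :
    koszulD (koszulCoeff x) (homotopy x (Finsupp.single J f)) =
      Finsupp.single J ((-1) ^ J.card * specialize x (height J) f) +
        ∑ r ∈ J, ∑ i ∈ Finset.univ.filter (fun i : Fin (n + 1) => height J ≤ i),
          Finsupp.single (insert i (J.erase r))
            ((-1) ^ (J.filter (· < r)).card * (koszulCoeff x r * dividedDiff x i f)) := by
  have hsum : Finsupp.single J ((-1) ^ J.card * specialize x (height J) f) =
      ∑ i ∈ Finset.univ.filter (fun i : Fin (n + 1) => height J ≤ i),
        Finsupp.single J ((-1) ^ J.card * (koszulCoeff x i * dividedDiff x i f)) := by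
    rw [← sum_koszulCoeff_mul_dividedDiff x (height_le_of_last_notMem hJ), Finset.mul_sum,
      Finsupp.single_finsetSum]
  rw [homotopy_single, map_sum, hsum, Finset.sum_comm (s := J), ← Finset.sum_add_distrib]
  refine Finset.sum_congr rfl fun i hi => ?_
  have hi : height J ≤ i := (Finset.mem_filter.1 hi).2
  have hiJ := notMem_of_height_le hi
  have hfilter : ∀ r ∈ J, (insert i J).filter (· < r) = J.filter (· < r) := fun r hr => by
    have hri : r < i := Fin.lt_def.2 (height_le_iff.1 hi r hr)
    rw [Finset.filter_insert, if_neg hri.not_gt]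
  have hfilter' : (insert i J).filter (· < i) = J := by
    rw [Finset.filter_insert, if_neg (lt_irrefl _), Finset.filter_true_of_mem]
    exact fun r hr => Fin.lt_def.2 (height_le_iff.1 hi r hr)
  rw [koszulD_single, Finset.sum_insert hiJ, Finset.erase_insert hiJ, hfilter']
  refine congrArg₂ (· + ·) rfl (Finset.sum_congr rfl fun r hr => ?_)
  have hri : r < i := Fin.lt_def.2 (height_le_iff.1 hi r hr)
  rw [hfilter r hr, Finset.erase_insert_of_ne hri.ne']

lemma homotopy_erase_single {J : Finset (Fin (n + 1))} (hJ : Fin.last n ∉ J) {r : Fin (n + 1)}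
    (hr : r ∈ J) (f : MvPolynomial (Fin n) S) :
    homotopy x (Finsupp.single (J.erase r)
        ((-1) ^ (J.filter (· < r)).card * (koszulCoeff x r * f))) =
      ∑ i ∈ Finset.univ.filter (fun i : Fin (n + 1) => height J ≤ i),
          Finsupp.single (insert i (J.erase r))
            ((-1) ^ (J.filter (· < r)).card * (koszulCoeff x r * dividedDiff x i f)) +
        if height J = r + 1 then
          Finsupp.single J ((-1) ^ J.card * specialize x (height J) f) else 0 := by
  have hrn : (r : ℕ) < n := by
    have := height_le_of_last_notMem hJ
    have := lt_height hr
    omega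
  have hcongr : ∑ i ∈ Finset.univ.filter (fun i : Fin (n + 1) => height J ≤ i),
      Finsupp.single (insert i (J.erase r)) (dividedDiff x i
        ((-1) ^ (J.filter (· < r)).card * (koszulCoeff x r * f))) =
      ∑ i ∈ Finset.univ.filter (fun i : Fin (n + 1) => height J ≤ i),
          Finsupp.single (insert i (J.erase r))
            ((-1) ^ (J.filter (· < r)).card * (koszulCoeff x r * dividedDiff x i f)) := by
    refine Finset.sum_congr rfl fun i hi => ?_
    rw [dividedDiff_neg_one_pow_mul, dividedDiff_koszulCoeff_of_gt]
    exact Fin.lt_def.2 (height_le_iff.1 (Finset.mem_filter.1 hi).2 r hr)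
  have hle : height (J.erase r) ≤ height J :=
    height_le_iff.2 fun i hi => lt_height (Finset.mem_of_mem_erase hi)
  rw [homotopy_single, ← hcongr]
  split_ifs with h
  · have hr' : height (J.erase r) ≤ r := height_le_iff.2 fun i hi => by
      have h1 := lt_height (Finset.mem_of_mem_erase hi)
      have h2 : (i : ℕ) ≠ r := fun h => Finset.ne_of_mem_erase hi (Fin.ext h)
      omega
    have hsub : insert r (Finset.univ.filter (fun i : Fin (n + 1) => height J ≤ i)) ⊆
        Finset.univ.filter (fun i : Fin (n + 1) => height (J.erase r) ≤ i) := by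
      intro i
      simp only [Finset.mem_insert, Finset.mem_filter, Finset.mem_univ, true_and]
      rintro (rfl | h)
      · exact hr'
      · omega
    rw [← Finset.sum_subset hsub, Finset.sum_insert,
      add_comm (Finsupp.single (insert r (J.erase r)) _)]
    · congr 1
      rw [Finset.insert_erase hr, dividedDiff_neg_one_pow_mul,
        dividedDiff_koszulCoeff_self x hrn, truncSpecialize_of_le x hrn, h]
      have hc : J.card = (J.filter (· < r)).card + 1 := by
        rw [← Finset.card_erase_add_one hr]
        congr 2
        ext i
        simp only [Finset.mem_erase, Finset.mem_filter]
        constructor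
        · rintro ⟨h1, h2⟩
          refine ⟨h2, Fin.lt_def.2 ?_⟩
          have := height_le_iff.1 hr' i (Finset.mem_erase.2 ⟨h1, h2⟩)
          exact this
        · exact fun ⟨h1, h2⟩ => ⟨h2.ne, h1⟩
      rw [hc, pow_succ]
      congr 1
      ring
    · simp only [Finset.mem_filter, Finset.mem_univ, true_and]
      omega
    · intro i _ hi
      simp only [Finset.mem_insert, Finset.mem_filter, Finset.mem_univ, true_and, not_or] at hi
      have hir : i < r := by
        rw [Fin.lt_def]
        have : (i : ℕ) ≠ r := fun h => hi.1 (Fin.ext h)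
        omega
      rw [dividedDiff_neg_one_pow_mul, dividedDiff_koszulCoeff_of_lt x hrn hir]
      simp
  · rw [add_zero]
    have : height (J.erase r) = height J := by
      refine le_antisymm hle (height_le_iff.2 fun i hi => ?_)
      by_cases hir : i = r
      · subst hir
        by_contra hcon
        refine h (le_antisymm (height_le_iff.2 fun j hj => ?_) (lt_height hr))
        by_cases hji : j = i
        · subst hji; omega
        · have := lt_height (Finset.mem_erase.2 ⟨hji, hj⟩)
          omega
      · exact lt_height (Finset.mem_erase.2 ⟨hir, hi⟩)
    rw [this]

lemma koszulD_homotopy_single {J : Finset (Fin (n + 1))} (hJ : Fin.last n ∉ J)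
    (f : MvPolynomial (Fin n) S) :
    koszulD (koszulCoeff x) (homotopy x (Finsupp.single J f)) =
      homotopy x (koszulD (koszulCoeff x) (Finsupp.single J f)) +
        Finsupp.single ∅ (specialize x 0 (Finsupp.single J f ∅)) := by
  rw [koszulD_homotopy_single_aux x hJ, koszulD_single, map_sum,
    Finset.sum_congr rfl fun r hr => homotopy_erase_single x hJ hr f, Finset.sum_add_distrib,
    add_comm (Finsupp.single J _), add_assoc]
  congr 1
  rcases J.eq_empty_or_nonempty with rfl | hne
  · simp [height]
  · rw [Finsupp.single_eq_of_ne hne.ne_empty.symm, map_zero, Finsupp.single_zero, add_zero]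
    obtain ⟨r, hr, hmax⟩ := Finset.exists_max_image J id hne
    have hh : height J = r + 1 := le_antisymm
      (height_le_iff.2 fun i hi => Nat.lt_succ_of_le (Fin.le_def.1 (hmax i hi))) (lt_height hr)
    rw [Finset.sum_eq_single r (fun j _ hj => if_neg fun h => hj (Fin.ext (by omega)))
      (fun h => absurd hr h), if_pos hh]

lemma koszulD_homotopy {a : Finset (Fin (n + 1)) →₀ MvPolynomial (Fin n) S}
    (ha : ∀ L, Fin.last n ∈ L → a L = 0) :
    koszulD (koszulCoeff x) (homotopy x a) = homotopy x (koszulD (koszulCoeff x) a) +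
      Finsupp.single ∅ (specialize x 0 (a ∅)) := by
  have hs : a = ∑ J ∈ a.support, Finsupp.single J (a J) := (Finsupp.sum_single a).symm
  let φ : (Finset (Fin (n + 1)) →₀ MvPolynomial (Fin n) S) →+
      (Finset (Fin (n + 1)) →₀ MvPolynomial (Fin n) S) :=
    (koszulD (koszulCoeff x)).toAddMonoidHom.comp (homotopy x).toAddMonoidHom
  let ψ : (Finset (Fin (n + 1)) →₀ MvPolynomial (Fin n) S) →+
      (Finset (Fin (n + 1)) →₀ MvPolynomial (Fin n) S) :=
    (homotopy x).toAddMonoidHom.comp (koszulD (koszulCoeff x)).toAddMonoidHom +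
      (Finsupp.singleAddHom ∅).comp ((specialize x 0 : _ →+ _).comp (Finsupp.applyAddHom ∅))
  change φ a = ψ a
  rw [hs, map_sum, map_sum]
  refine Finset.sum_congr rfl fun J hJ => koszulD_homotopy_single x (fun h => ?_) _
  exact Finsupp.mem_support_iff.1 hJ (ha J h)

end Homotopy

section Specialized

variable {n t : ℕ} {S : Type} [CommRing S] (x : Fin n → S) (m : Fin t → (Fin n →₀ ℕ))

/-- The polynomials not involving the variables with index at least `a`. -/
noncomputable def specialized (a : ℕ) : AddSubgroup (MvPolynomial (Fin n) S) :=
  (LinearMap.eqLocus (specialize x a).toLinearMap LinearMap.id).toAddSubgroup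

/-- The coefficients allowed at `e_L`: elements of the monomial ideal if `L` contains the last
index, and polynomials in the variables below `L` otherwise. -/
noncomputable def specializedCoeff (L : Finset (Fin (n + 1))) :
    AddSubgroup (MvPolynomial (Fin n) S) :=
  if Fin.last n ∈ L then (monomialIdeal S m).toAddSubgroup else specialized x (height L)

lemma mem_specializedCoeff_of_mem {L : Finset (Fin (n + 1))} (h : Fin.last n ∈ L)
    {f : MvPolynomial (Fin n) S} : f ∈ specializedCoeff x m L ↔ f ∈ monomialIdeal S m := by
  rw [specializedCoeff, if_pos h]; rfl

lemma mem_specializedCoeff_of_notMem {L : Finset (Fin (n + 1))} (h : Fin.last n ∉ L)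
    {f : MvPolynomial (Fin n) S} :
    f ∈ specializedCoeff x m L ↔ specialize x (height L) f = f := by
  rw [specializedCoeff, if_neg h]; rfl

/-- The coefficients at `e_L` of the Koszul complex tensored with the monomial ideal, not involving
the last generator. -/
noncomputable def idealCoeff (S : Type) [CommRing S] (m : Fin t → (Fin n →₀ ℕ))
    (L : Finset (Fin (n + 1))) : AddSubgroup (MvPolynomial (Fin n) S) :=
  if Fin.last n ∈ L then ⊥ else (monomialIdeal S m).toAddSubgroup

lemma mem_idealCoeff {L : Finset (Fin (n + 1))} {f : MvPolynomial (Fin n) S} :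
    f ∈ idealCoeff S m L ↔ f ∈ monomialIdeal S m ∧ (Fin.last n ∈ L → f = 0) := by
  unfold idealCoeff
  split_ifs with h
  · rw [AddSubgroup.mem_bot]
    exact ⟨fun hf => ⟨hf ▸ zero_mem _, fun _ => hf⟩, fun hf => hf.2 h⟩
  · exact ⟨fun hf => ⟨hf, fun h' => absurd h' h⟩, fun hf => hf.1⟩

lemma specializedCoeff_mul_mem {L M : Finset (Fin (n + 1))} {f g : MvPolynomial (Fin n) S}
    (hf : f ∈ specializedCoeff x m L) (hg : g ∈ specializedCoeff x m M) :
    f * g ∈ specializedCoeff x m (L ∪ M) := by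
  by_cases hL : Fin.last n ∈ L
  · rw [mem_specializedCoeff_of_mem x m (Finset.mem_union_left _ hL)]
    exact Ideal.mul_mem_right _ _ ((mem_specializedCoeff_of_mem x m hL).1 hf)
  by_cases hM : Fin.last n ∈ M
  · rw [mem_specializedCoeff_of_mem x m (Finset.mem_union_right _ hM)]
    exact Ideal.mul_mem_left _ _ ((mem_specializedCoeff_of_mem x m hM).1 hg)
  rw [mem_specializedCoeff_of_notMem x m (by simp [hL, hM]), map_mul,
    specialize_eq_of_le x _ ((mem_specializedCoeff_of_notMem x m hL).1 hf),
    specialize_eq_of_le x _ ((mem_specializedCoeff_of_notMem x m hM).1 hg)]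
  · exact height_le_iff.2 fun i hi => lt_height (Finset.mem_union_right _ hi)
  · exact height_le_iff.2 fun i hi => lt_height (Finset.mem_union_left _ hi)

/-- Elements with specialized coefficients whose Koszul differential has the same property. -/
noncomputable def specializedSubgroup :
    AddSubgroup (Finset (Fin (n + 1)) →₀ MvPolynomial (Fin n) S) :=
  coefSubgroup (specializedCoeff x m) ⊓
    (coefSubgroup (specializedCoeff x m)).comap (koszulD (koszulCoeff x)).toAddMonoidHom

lemma mem_specializedSubgroup {z : Finset (Fin (n + 1)) →₀ MvPolynomial (Fin n) S} :
    z ∈ specializedSubgroup x m ↔ z ∈ coefSubgroup (specializedCoeff x m) ∧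
      koszulD (koszulCoeff x) z ∈ coefSubgroup (specializedCoeff x m) := Iff.rfl

lemma extMul_mem_specializedSubgroup {p : ℕ}
    {z w : Finset (Fin (n + 1)) →₀ MvPolynomial (Fin n) S} (hp : z ∈ extDegree _ _ p)
    (hz : z ∈ specializedSubgroup x m) (hw : w ∈ specializedSubgroup x m) :
    extMul _ _ z w ∈ specializedSubgroup x m := by
  rw [mem_specializedSubgroup] at *
  have hmul : ∀ {z w : Finset (Fin (n + 1)) →₀ MvPolynomial (Fin n) S},
      z ∈ coefSubgroup (specializedCoeff x m) → w ∈ coefSubgroup (specializedCoeff x m) →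
        extMul _ _ z w ∈ coefSubgroup (specializedCoeff x m) :=
    extMul_mem_coefSubgroup fun L M _ f hf g hg => specializedCoeff_mul_mem x m hf hg
  refine ⟨hmul hz.1 hw.1, ?_⟩
  rw [koszulD_mul _ hp]
  exact add_mem (hmul hz.2 hw.1) (zsmul_mem (hmul hz.1 hw.2) _)

lemma single_empty_mem_coefSubgroup (f : MvPolynomial (Fin n) S) :
    Finsupp.single ∅ (specialize x 0 f) ∈ coefSubgroup (specializedCoeff x m) := by
  refine single_mem_coefSubgroup ?_
  rw [mem_specializedCoeff_of_notMem x m (by simp)]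
  simp [height, specialize_specialize]

lemma single_empty_mem_specializedSubgroup (f : MvPolynomial (Fin n) S) :
    Finsupp.single ∅ (specialize x 0 f) ∈ specializedSubgroup x m := by
  refine ⟨single_empty_mem_coefSubgroup x m f, ?_⟩
  simp [koszulD_single, zero_mem]

lemma koszulD_mem_idealCoeff {a : Finset (Fin (n + 1)) →₀ MvPolynomial (Fin n) S}
    (ha : a ∈ coefSubgroup (idealCoeff S m)) :
    koszulD (koszulCoeff x) a ∈ coefSubgroup (idealCoeff S m) := by
  refine koszulD_mem_coefSubgroup (fun L r hr f hf => ?_) ha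
  rw [mem_idealCoeff] at hf ⊢
  refine ⟨Ideal.mul_mem_left _ _ hf.1, fun h => ?_⟩
  rw [hf.2 (Finset.mem_of_mem_erase h), mul_zero]

/-- The part of an element divisible by the last generator. -/
noncomputable def lastPart {R : Type} [CommRing R] (z : Finset (Fin (n + 1)) →₀ R) :
    Finset (Fin (n + 1)) →₀ R :=
  Finsupp.equivFunOnFinite.symm fun L => if Fin.last n ∈ L then 0 else z (insert (Fin.last n) L)

lemma lastPart_apply {R : Type} [CommRing R] (z : Finset (Fin (n + 1)) →₀ R)
    (L : Finset (Fin (n + 1))) :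
    lastPart z L = if Fin.last n ∈ L then 0 else z (insert (Fin.last n) L) := rfl

lemma lastPart_mem_idealCoeff {z : Finset (Fin (n + 1)) →₀ MvPolynomial (Fin n) S}
    (hz : z ∈ coefSubgroup (specializedCoeff x m)) :
    lastPart z ∈ coefSubgroup (idealCoeff S m) := by
  intro L
  rw [mem_idealCoeff, lastPart_apply]
  split_ifs with h
  · exact ⟨zero_mem _, fun _ => rfl⟩
  · exact ⟨(mem_specializedCoeff_of_mem x m (Finset.mem_insert_self _ _)).1 (hz _),
      fun h' => absurd h' h⟩

section Domain

variable [IsDomain S]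

lemma homotopy_mem_coefSubgroup {a : Finset (Fin (n + 1)) →₀ MvPolynomial (Fin n) S}
    (ha : a ∈ coefSubgroup (idealCoeff S m)) :
    homotopy x a ∈ coefSubgroup (specializedCoeff x m) := by
  refine map_mem_of_mem_coefSubgroup (homotopy x).toAddMonoidHom (fun L f hf => ?_) ha
  rw [LinearMap.toAddMonoidHom_coe, homotopy_single]
  refine sum_mem fun i hi => single_mem_coefSubgroup ?_
  have hi : height L ≤ i := (Finset.mem_filter.1 hi).2
  rw [mem_idealCoeff] at hf
  by_cases hlast : i = Fin.last n
  · subst hlast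
    rw [mem_specializedCoeff_of_mem x m (Finset.mem_insert_self _ _), dividedDiff_last]
    exact hf.1
  · by_cases hL : Fin.last n ∈ L
    · rw [hf.2 hL, map_zero]
      exact zero_mem _
    · rw [mem_specializedCoeff_of_notMem x m (by simp [hL, Ne.symm hlast])]
      refine specialize_eq_of_le x ?_ (specialize_dividedDiff x i f)
      exact lt_height (Finset.mem_insert_self _ _)

lemma homotopy_mem_specializedSubgroup {a : Finset (Fin (n + 1)) →₀ MvPolynomial (Fin n) S}
    (ha : a ∈ coefSubgroup (idealCoeff S m)) :
    homotopy x a ∈ specializedSubgroup x m := by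
  refine (mem_specializedSubgroup x m).2 ⟨homotopy_mem_coefSubgroup x m ha, ?_⟩
  rw [koszulD_homotopy x fun L hL => ((mem_idealCoeff m).1 (ha L)).2 hL]
  exact add_mem (homotopy_mem_coefSubgroup x m (koszulD_mem_idealCoeff x m ha))
    (single_empty_mem_coefSubgroup x m _)

lemma eq_zero_of_specialized {z : Finset (Fin (n + 1)) →₀ MvPolynomial (Fin n) S}
    (hz : z ∈ specializedSubgroup x m) (h0 : ∀ L, Fin.last n ∈ L → z L = 0)
    {L : Finset (Fin (n + 1))} (hL : L.Nonempty) : z L = 0 := by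
  by_cases hlast : Fin.last n ∈ L
  · exact h0 L hlast
  obtain ⟨i, hiL, hmax⟩ := Finset.exists_max_image L id hL
  obtain ⟨M, hiM, rfl⟩ : ∃ M, i ∉ M ∧ insert i M = L :=
    ⟨L.erase i, Finset.notMem_erase _ _, Finset.insert_erase hiL⟩
  have hM : height M ≤ i := height_le_iff.2 fun j hj => by
    have h1 : j ≤ i := hmax j (Finset.mem_insert_of_mem hj)
    exact Fin.lt_def.1 (lt_of_le_of_ne h1 fun h => hiM (h ▸ hj))
  have hMlast : Fin.last n ∉ M := fun h => hlast (Finset.mem_insert_of_mem h)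
  have hin : (i : ℕ) < n :=
    lt_of_lt_of_le (lt_height (Finset.mem_insert_self _ _)) (height_le_of_last_notMem hlast)
  let T : Fin (n + 1) → MvPolynomial (Fin n) S := fun j =>
    if j ∈ M then 0 else (-1) ^ (M.filter (· < j)).card * (koszulCoeff x j * z (insert j M))
  have hT : ∀ a ≤ n, height M ≤ a →
      ∑ j : Fin (n + 1), (if (j : ℕ) < a then T j else 0) = koszulD (koszulCoeff x) z M := by
    intro a han ha
    have hs := (mem_specializedCoeff_of_notMem x m hMlast).1
      (((mem_specializedSubgroup x m).1 hz).2 M)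
    rw [← specialize_eq_of_le x ha hs, koszulD_apply, map_sum]
    refine Finset.sum_congr rfl fun j _ => ?_
    by_cases hj : j ∈ M
    · simp [T, hj]
    simp only [T, if_neg hj, map_mul, map_pow, map_neg, map_one]
    split_ifs with hja
    · rw [specialize_koszulCoeff_of_lt x hja]
      have hjl : Fin.last n ∉ insert j M := by
        rw [Finset.mem_insert, not_or]
        refine ⟨fun h => ?_, hMlast⟩
        rw [← h, Fin.val_last] at hja
        omega
      rw [specialize_eq_of_le x _ ((mem_specializedCoeff_of_notMem x m hjl).1 (hz.1 _))]
      refine height_le_iff.2 fun l hl => ?_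
      rcases Finset.mem_insert.1 hl with rfl | hl
      · exact hja
      · exact lt_of_lt_of_le (lt_height hl) ha
    · by_cases hjn : (j : ℕ) < n
      · rw [specialize_koszulCoeff_of_le x hjn (not_lt.1 hja)]
        simp
      · have : Fin.last n = j := Fin.ext (by rw [Fin.val_last]; omega)
        rw [h0 (insert j M) (this ▸ Finset.mem_insert_self _ _)]
        simp
  have h1 := (hT (i + 1) hin (hM.trans (Nat.le_succ _))).trans (hT i hin.le hM).symm
  rw [← sub_eq_zero, ← Finset.sum_sub_distrib, Finset.sum_eq_single i] at h1
  · rw [if_pos (Nat.lt_succ_self _), if_neg (lt_irrefl _), sub_zero] at h1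
    simp only [T, if_neg hiM] at h1
    simpa [koszulCoeff_ne_zero] using h1
  · intro j _ hji
    have : (j : ℕ) ≠ i := fun h => hji (Fin.ext h)
    split_ifs <;> first | omega | simp
  · simp

lemma homotopy_apply_empty (a : Finset (Fin (n + 1)) →₀ MvPolynomial (Fin n) S) :
    homotopy x a ∅ = 0 := by
  rw [← Finsupp.sum_single a, Finsupp.sum, map_sum, Finsupp.finsetSum_apply]
  refine Finset.sum_eq_zero fun L _ => ?_
  rw [homotopy_single, Finsupp.finsetSum_apply]
  exact Finset.sum_eq_zero fun i _ => Finsupp.single_eq_of_ne (Finset.insert_ne_empty _ _).symm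

lemma homotopy_apply_insert_last {a : Finset (Fin (n + 1)) →₀ MvPolynomial (Fin n) S}
    (ha : ∀ L, Fin.last n ∈ L → a L = 0) {M : Finset (Fin (n + 1))} (hM : Fin.last n ∉ M) :
    homotopy x a (insert (Fin.last n) M) = a M := by
  conv_lhs => rw [← Finsupp.sum_single a]
  conv_rhs => rw [← Finsupp.sum_single a]
  rw [Finsupp.sum, map_sum, Finsupp.finsetSum_apply, Finsupp.finsetSum_apply]
  refine Finset.sum_congr rfl fun L hL => ?_
  have hL : Fin.last n ∉ L := fun h => Finsupp.mem_support_iff.1 hL (ha L h)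
  rw [homotopy_single, Finsupp.finsetSum_apply, Finset.sum_eq_single (Fin.last n)]
  · rw [dividedDiff_last, Finsupp.single_apply, Finsupp.single_apply]
    refine if_congr ⟨fun h => ?_, fun h => by rw [h]⟩ rfl rfl
    rw [← Finset.erase_insert hL, h, Finset.erase_insert hM]
  · intro i _ hi
    refine Finsupp.single_eq_of_ne fun h => ?_
    have := h ▸ Finset.mem_insert_self (Fin.last n) M
    rw [Finset.mem_insert] at this
    exact this.elim (fun h => hi h.symm) hL
  · intro h
    refine absurd (Finset.mem_filter.2 ⟨Finset.mem_univ _, ?_⟩) h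
    exact height_le_of_last_notMem hL

lemma eq_single_add_homotopy {z : Finset (Fin (n + 1)) →₀ MvPolynomial (Fin n) S}
    (hz : z ∈ specializedSubgroup x m) :
    z = Finsupp.single ∅ (specialize x 0 (z ∅)) + homotopy x (lastPart z) := by
  have hI := lastPart_mem_idealCoeff x m hz.1
  have h0 : specialize x 0 (z ∅) = z ∅ := by
    simpa [height] using (mem_specializedCoeff_of_notMem x m (by simp)).1 (hz.1 ∅)
  have hw := sub_mem hz (homotopy_mem_specializedSubgroup x m hI)
  rw [h0, ← sub_eq_iff_eq_add]
  ext1 L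
  rcases L.eq_empty_or_nonempty with rfl | hL
  · rw [Finsupp.sub_apply, homotopy_apply_empty, sub_zero, Finsupp.single_eq_same]
  · rw [Finsupp.single_eq_of_ne hL.ne_empty]
    refine eq_zero_of_specialized x m hw (fun M hM => ?_) hL
    obtain ⟨M, hM', rfl⟩ : ∃ M', Fin.last n ∉ M' ∧ insert (Fin.last n) M' = M :=
      ⟨M.erase (Fin.last n), Finset.notMem_erase _ _, Finset.insert_erase hM⟩
    rw [Finsupp.sub_apply, homotopy_apply_insert_last x
      (fun L hL => ((mem_idealCoeff m).1 (hI L)).2 hL) hM', lastPart_apply, if_neg hM', sub_self]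

end Domain

end Specialized

section HomotopyDegree

variable {n : ℕ} {S : Type} [CommRing S] [IsDomain S] (x : Fin n → S)

lemma homotopy_mem_extDegree {p : ℕ} {z : Finset (Fin (n + 1)) →₀ MvPolynomial (Fin n) S}
    (hz : z ∈ extDegree _ _ p) : homotopy x z ∈ extDegree _ _ (p + 1) := by
  refine extDegree_induction (P := fun z => homotopy x z ∈ extDegree _ _ (p + 1)) (by simp)
    (fun x y hx hy => by simpa using add_mem hx hy) (fun L f hL => ?_) hz
  rw [homotopy_single]
  refine sum_mem fun i hi => single_mem_extDegree ?_ _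
  rw [Finset.card_insert_of_notMem (notMem_of_height_le (Finset.mem_filter.1 hi).2), hL]

end HomotopyDegree

section DegreeApply

variable {R ι : Type} [CommRing R]

lemma apply_eq_zero_of_mem_extDegree {p : ℕ} {z : Finset ι →₀ R} (hz : z ∈ extDegree R ι p)
    {L : Finset ι} (hL : L.card ≠ p) : z L = 0 := by
  by_contra h
  exact hL ((Finsupp.mem_supported R z).1 hz (Finsupp.mem_support_iff.2 h))

end DegreeApply

section Embedding

variable {n : ℕ}

/-- A set of indices of variables, as a set of indices of generators. -/
def castIndices (J : Finset (Fin n)) : Finset (Fin (n + 1)) := J.map Fin.castSuccEmb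

lemma last_notMem_castIndices (J : Finset (Fin n)) : Fin.last n ∉ castIndices J := by
  simp [castIndices, Fin.castSucc_ne_last]

lemma castSucc_mem_castIndices {J : Finset (Fin n)} {c : Fin n} :
    c.castSucc ∈ castIndices J ↔ c ∈ J := by
  simp [castIndices]

lemma card_castIndices (J : Finset (Fin n)) : (castIndices J).card = J.card :=
  Finset.card_map _

lemma castIndices_injective : Function.Injective (castIndices (n := n)) :=
  Finset.map_injective _

lemma castIndices_erase (J : Finset (Fin n)) (j : Fin n) :
    (castIndices J).erase j.castSucc = castIndices (J.erase j) :=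
  (Finset.map_erase Fin.castSuccEmb J j).symm

lemma exists_castIndices {L : Finset (Fin (n + 1))} (h : Fin.last n ∉ L) :
    ∃ J, castIndices J = L := by
  refine ⟨Finset.univ.filter fun c => c.castSucc ∈ L, ?_⟩
  ext i
  induction i using Fin.lastCases with
  | last => simp [h, last_notMem_castIndices]
  | cast i => simp [castSucc_mem_castIndices]

lemma koszulD_castIndices_single {S : Type} [CommRing S] (x : Fin n → S) (J : Finset (Fin n))
    (f : MvPolynomial (Fin n) S) :
    koszulD (koszulCoeff x) (Finsupp.single (castIndices J) f) =
      ∑ j ∈ J, Finsupp.single (castIndices (J.erase j))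
        ((-1) ^ (J.filter (· < j)).card * ((C (x j) - X j) * f)) := by
  rw [koszulD_single]
  conv_lhs => rw [castIndices, Finset.sum_map]
  refine Finset.sum_congr rfl fun j _ => ?_
  change Finsupp.single ((castIndices J).erase j.castSucc)
    ((-1) ^ ((castIndices J).filter (· < j.castSucc)).card * (koszulCoeff x j.castSucc * f)) = _
  rw [castIndices_erase, koszulCoeff_castSucc]
  congr 3
  rw [castIndices, Finset.filter_map, Finset.card_map]
  rfl

lemma C_aeval {S : Type} [CommRing S] (x : Fin n → S) (f : MvPolynomial (Fin n) S) :
    C (aeval x f) = specialize x 0 f := by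
  induction f using MvPolynomial.induction_on with
  | C s => rw [specialize_C, aeval_C]; rfl
  | add p q hp hq => rw [map_add, map_add, map_add, hp, hq]
  | mul_X p l hp => rw [map_mul, map_mul, map_mul, hp, specialize_X, aeval_X]; simp

end Embedding

section Transfer

variable {k : Type} [Field k] {n t : ℕ} (m : Fin t → (Fin n →₀ ℕ))

instance (p : ℕ) : Finite (EKIndex k n t m p) :=
  inferInstanceAs (Finite {q : Fin t × Finset (Fin n) //
    ↑q.2 ⊆ critSet k n t m q.1 ∧ q.2.card = p})

/-- The index of `e_J g_i`. -/
def ekIndex {p : ℕ} (i : Fin t) (J : Finset (Fin n)) (h1 : ↑J ⊆ critSet k n t m i)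
    (h2 : J.card = p) : EKIndex k n t m p :=
  ⟨(i, J), h1, h2⟩

variable {m}

/-- The generator in the index of a basis element. -/
def EKIndex.gen {p : ℕ} (q : EKIndex k n t m p) : Fin t := q.1.1

/-- The set of variables in the index of a basis element. -/
def EKIndex.vars {p : ℕ} (q : EKIndex k n t m p) : Finset (Fin n) := q.1.2

lemma EKIndex.vars_subset {p : ℕ} (q : EKIndex k n t m p) : ↑q.vars ⊆ critSet k n t m q.gen :=
  q.2.1

lemma EKIndex.card_vars {p : ℕ} (q : EKIndex k n t m p) : q.vars.card = p := q.2.2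

lemma EKIndex.eq_ekIndex {p : ℕ} (q : EKIndex k n t m p) :
    q = ekIndex m q.gen q.vars q.vars_subset q.card_vars := rfl

lemma ekIndex_eq_iff {p : ℕ} {i : Fin t} {J : Finset (Fin n)} {h1 : ↑J ⊆ critSet k n t m i}
    {h2 : J.card = p} {q : EKIndex k n t m p} :
    q = ekIndex m i J h1 h2 ↔ q.gen = i ∧ q.vars = J :=
  Subtype.ext_iff.trans Prod.ext_iff

variable (k m)

/-- The module in degree `0` is `S`. -/
noncomputable def ekZero : EKMod k n t m 0 ≃ₗ[MvPolynomial (Fin n) k] MvPolynomial (Fin n) k :=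
  LinearEquiv.refl _ _

/-- The module in degree `p + 1` is the free module on the index set. -/
noncomputable def ekSucc (p : ℕ) : EKMod k n t m (p + 1) ≃ₗ[MvPolynomial (Fin n) k]
    (EKIndex k n t m p →₀ MvPolynomial (Fin n) k) :=
  LinearEquiv.refl _ _

variable {k}

/-- The `S`-linear map sending `e_J g_i` to `y^{m i} e_J`. -/
noncomputable def monomialLift (p : ℕ) : (EKIndex k n t m p →₀ MvPolynomial (Fin n) k)
    →ₗ[MvPolynomial (Fin n) k]
      (Finset (Fin (n + 1)) →₀ MvPolynomial (Fin n) (MvPolynomial (Fin n) k)) :=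
  Finsupp.lsum (MvPolynomial (Fin n) k) fun q =>
    LinearMap.toSpanSingleton (MvPolynomial (Fin n) k) _
      (Finsupp.single (castIndices q.vars) (monomial (m q.gen) 1))

lemma monomialLift_single {p : ℕ} (q : EKIndex k n t m p) (s : MvPolynomial (Fin n) k) :
    monomialLift m p (Finsupp.single q s) =
      Finsupp.single (castIndices q.vars) (C s * monomial (m q.gen) 1) := by
  rw [monomialLift, Finsupp.lsum_single, LinearMap.toSpanSingleton_apply, Finsupp.smul_single,
    smul_eq_C_mul]

lemma monomialLift_apply {p : ℕ} (a : EKIndex k n t m p →₀ MvPolynomial (Fin n) k)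
    {J : Finset (Fin n)} (hJ : J.card = p) :
    monomialLift m p a (castIndices J) =
      ∑ i, if h : ↑J ⊆ critSet k n t m i then
        C (a (ekIndex m i J h hJ)) * monomial (m i) 1 else 0 := by
  induction a using Finsupp.induction_linear with
  | zero => simp only [map_zero, Finsupp.zero_apply, zero_mul, dite_eq_ite, ite_self,
      Finset.sum_const_zero]
  | add a b ha hb =>
    rw [map_add, Finsupp.add_apply, ha, hb, ← Finset.sum_add_distrib]
    refine Finset.sum_congr rfl fun i _ => ?_
    split_ifs
    · rw [Finsupp.add_apply, C_add, add_mul]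
    · rw [add_zero]
  | single q s =>
    rw [monomialLift_single]
    by_cases hJJ : q.vars = J
    · subst hJJ
      rw [Finsupp.single_eq_same, Finset.sum_eq_single q.gen, dif_pos q.vars_subset,
        ← q.eq_ekIndex, Finsupp.single_eq_same]
      · intro i' _ hi
        split_ifs with h
        · rw [Finsupp.single_eq_of_ne', C_0, zero_mul]
          exact fun h => hi (ekIndex_eq_iff.1 h).1.symm
        · rfl
      · simp
    · rw [Finsupp.single_eq_of_ne fun h => hJJ (castIndices_injective h.symm)]
      refine (Finset.sum_eq_zero fun i' _ => ?_).symm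
      split_ifs with h
      · rw [Finsupp.single_eq_of_ne', C_0, zero_mul]
        exact fun h => hJJ (ekIndex_eq_iff.1 h).2
      · rfl

lemma monomialLift_mem_idealCoeff {p : ℕ} (a : EKIndex k n t m p →₀ MvPolynomial (Fin n) k) :
    monomialLift m p a ∈ coefSubgroup (idealCoeff (MvPolynomial (Fin n) k) m) := by
  induction a using Finsupp.induction_linear with
  | zero => rw [map_zero]; exact zero_mem _
  | add a b ha hb => rw [map_add]; exact add_mem ha hb
  | single q s =>
    rw [monomialLift_single]
    refine single_mem_coefSubgroup ((mem_idealCoeff m).2 ⟨?_, fun h => ?_⟩)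
    · exact Ideal.mul_mem_left _ _ (Ideal.subset_span ⟨_, rfl⟩)
    · exact absurd h (last_notMem_castIndices _)

lemma monomialLift_mem_extDegree {p : ℕ} (a : EKIndex k n t m p →₀ MvPolynomial (Fin n) k) :
    monomialLift m p a ∈ extDegree _ _ p := by
  induction a using Finsupp.induction_linear with
  | zero => rw [map_zero]; exact zero_mem _
  | add a b ha hb => rw [map_add]; exact add_mem ha hb
  | single q s =>
    rw [monomialLift_single]
    exact single_mem_extDegree ((card_castIndices _).trans q.card_vars) _

/-- The embedding of the Eliahou–Kervaire complex into the exterior algebra. -/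
noncomputable def ekLift : ∀ p : ℕ, EKMod k n t m p →ₗ[MvPolynomial (Fin n) k]
    (Finset (Fin (n + 1)) →₀ MvPolynomial (Fin n) (MvPolynomial (Fin n) k))
  | 0 => Finsupp.lsingle ∅ ∘ₗ Algebra.linearMap (MvPolynomial (Fin n) k) _ ∘ₗ
      (ekZero k m).toLinearMap
  | p + 1 => homotopy X ∘ₗ monomialLift m p ∘ₗ (ekSucc k m p).toLinearMap

lemma ekLift_zero (a : EKMod k n t m 0) :
    ekLift m 0 a = Finsupp.single ∅ (C (ekZero k m a)) := rfl

lemma ekLift_succ (p : ℕ) (a : EKMod k n t m (p + 1)) :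
    ekLift m (p + 1) a = homotopy X (monomialLift m p (ekSucc k m p a)) := rfl

/-- The projection of the exterior algebra onto the Eliahou–Kervaire complex. -/
noncomputable def ekProj : ∀ p : ℕ,
    (Finset (Fin (n + 1)) →₀ MvPolynomial (Fin n) (MvPolynomial (Fin n) k))
      →ₗ[MvPolynomial (Fin n) k] EKMod k n t m p
  | 0 => (ekZero k m).symm.toLinearMap ∘ₗ
      (aeval (X : Fin n → MvPolynomial (Fin n) k)).toLinearMap ∘ₗ
      Finsupp.lapply ∅
  | p + 1 => (ekSucc k m p).symm.toLinearMap ∘ₗ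
    (Finsupp.linearEquivFunOnFinite (MvPolynomial (Fin n) k) (MvPolynomial (Fin n) k)
      (EKIndex k n t m p)).symm.toLinearMap ∘ₗ LinearMap.pi fun q =>
        beginningCoeff X m q.gen ∘ₗ Finsupp.lapply (insert (Fin.last n) (castIndices q.vars))

lemma ekProj_zero (z : Finset (Fin (n + 1)) →₀ MvPolynomial (Fin n) (MvPolynomial (Fin n) k)) :
    ekZero k m (ekProj m 0 z) = aeval (X : Fin n → MvPolynomial (Fin n) k) (z ∅) := rfl

lemma ekProj_succ_apply (p : ℕ)
    (z : Finset (Fin (n + 1)) →₀ MvPolynomial (Fin n) (MvPolynomial (Fin n) k))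
    (q : EKIndex k n t m p) :
    ekSucc k m p (ekProj m (p + 1) z) q =
      beginningCoeff X m q.gen (z (insert (Fin.last n) (castIndices q.vars))) := rfl

lemma ekLift_mem_specializedSubgroup (p : ℕ) (a : EKMod k n t m p) :
    ekLift m p a ∈ specializedSubgroup X m := by
  cases p with
  | zero =>
    rw [ekLift_zero, ← specialize_C X 0]
    exact single_empty_mem_specializedSubgroup _ _ _
  | succ p =>
    rw [ekLift_succ]
    exact homotopy_mem_specializedSubgroup _ _ (monomialLift_mem_idealCoeff _ _)

lemma ekLift_mem_extDegree (p : ℕ) (a : EKMod k n t m p) : ekLift m p a ∈ extDegree _ _ p := by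
  cases p with
  | zero => exact single_mem_extDegree rfl _
  | succ p => exact homotopy_mem_extDegree _ (monomialLift_mem_extDegree _ _)

lemma ekProj_homotopy_apply (p : ℕ)
    {a : Finset (Fin (n + 1)) →₀ MvPolynomial (Fin n) (MvPolynomial (Fin n) k)}
    (ha : ∀ L, Fin.last n ∈ L → a L = 0) (q : EKIndex k n t m p) :
    ekSucc k m p (ekProj m (p + 1) (homotopy X a)) q =
      beginningCoeff X m q.gen (a (castIndices q.vars)) := by
  rw [ekProj_succ_apply, homotopy_apply_insert_last X ha (last_notMem_castIndices _)]

lemma beginningCoeff_C_mul (i : Fin t) (s : MvPolynomial (Fin n) k)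
    (f : MvPolynomial (Fin n) (MvPolynomial (Fin n) k)) :
    beginningCoeff X m i (C s * f) = s * beginningCoeff X m i f := by
  rw [← smul_eq_C_mul, map_smul, smul_eq_mul]

variable {m}

lemma beginningCoeff_monomial_self (hmin : ∀ i j : Fin t, i ≠ j → ¬ m i ≤ m j) (i j : Fin t) :
    beginningCoeff (X : Fin n → MvPolynomial (Fin n) k) m i (monomial (m j) 1) =
      if i = j then 1 else 0 := by
  rw [beginningCoeff_monomial]
  refine if_ctx_congr ⟨fun h => h.unique hmin (isBeginning_self m j), fun h => ?_⟩
    (fun h => ?_) fun _ => rfl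
  · rw [h]; exact isBeginning_self m j
  · rw [h, tsub_self]; exact Finsupp.prod_zero_index

lemma ekProj_ekLift (hmin : ∀ i j : Fin t, i ≠ j → ¬ m i ≤ m j) (p : ℕ) (a : EKMod k n t m p) :
    ekProj m p (ekLift m p a) = a := by
  cases p with
  | zero =>
    refine (ekZero k m).injective ?_
    rw [ekProj_zero, ekLift_zero, Finsupp.single_eq_same, aeval_C]
    rfl
  | succ p =>
    refine (ekSucc k m p).injective (Finsupp.ext fun q => ?_)
    rw [ekLift_succ, ekProj_homotopy_apply m p (fun L hL =>
      ((mem_idealCoeff m).1 (monomialLift_mem_idealCoeff m _ L)).2 hL) q,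
      monomialLift_apply m _ q.card_vars, map_sum, Finset.sum_eq_single q.gen,
      dif_pos q.vars_subset, beginningCoeff_C_mul, beginningCoeff_monomial_self hmin, if_pos rfl,
      mul_one, ← q.eq_ekIndex]
    · intro j _ hj
      split_ifs
      · rw [beginningCoeff_C_mul, beginningCoeff_monomial_self hmin, if_neg hj.symm, mul_zero]
      · exact map_zero _
    · simp

/-- The coefficients at `e_L` of the kernel of the projection. -/
noncomputable def koszulNull {S : Type} [CommRing S] (x : Fin n → S)
    (m : Fin t → (Fin n →₀ ℕ)) :
    AddSubgroup (Finset (Fin (n + 1)) →₀ MvPolynomial (Fin n) S) :=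
  coefSubgroup fun L => (nullIdeal x m L).toAddSubgroup

lemma homotopy_mem_koszulNull {S : Type} [CommRing S] [IsDomain S] (x : Fin n → S)
    {z : Finset (Fin (n + 1)) →₀ MvPolynomial (Fin n) S} (hz : z ∈ koszulNull x m) :
    homotopy x z ∈ koszulNull x m := by
  refine map_mem_of_mem_coefSubgroup (homotopy x).toAddMonoidHom (fun L f hf => ?_) hz
  rw [LinearMap.toAddMonoidHom_coe, homotopy_single]
  exact sum_mem fun i hi => single_mem_coefSubgroup
    (dividedDiff_mem_nullIdeal x (Finset.mem_filter.1 hi).2 hf)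

lemma koszulD_mem_koszulNull {S : Type} [CommRing S] (x : Fin n → S)
    {z : Finset (Fin (n + 1)) →₀ MvPolynomial (Fin n) S} (hz : z ∈ koszulNull x m) :
    koszulD (koszulCoeff x) z ∈ koszulNull x m :=
  koszulD_mem_coefSubgroup (fun _ r _ _ hf => koszulCoeff_mul_mem_nullIdeal_erase x m r hf) hz

lemma extMul_mem_koszulNull_right {S : Type} [CommRing S] (x : Fin n → S)
    {z : Finset (Fin (n + 1)) →₀ MvPolynomial (Fin n) S} (hz : z ∈ koszulNull x m)
    (w : Finset (Fin (n + 1)) →₀ MvPolynomial (Fin n) S) :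
    extMul _ _ z w ∈ koszulNull x m :=
  extMul_mem_coefSubgroup (P' := fun _ => ⊤) (fun _ _ _ _ hf _ _ =>
    nullIdeal_mono x m Finset.subset_union_left (Ideal.mul_mem_right _ _ hf)) hz fun _ => trivial

lemma extMul_mem_koszulNull_left {S : Type} [CommRing S] (x : Fin n → S)
    (z : Finset (Fin (n + 1)) →₀ MvPolynomial (Fin n) S)
    {w : Finset (Fin (n + 1)) →₀ MvPolynomial (Fin n) S} (hw : w ∈ koszulNull x m) :
    extMul _ _ z w ∈ koszulNull x m :=
  extMul_mem_coefSubgroup (P := fun _ => ⊤) (fun _ _ _ _ _ _ hg =>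
    nullIdeal_mono x m Finset.subset_union_right (Ideal.mul_mem_left _ _ hg))
    (fun _ => trivial) hw

lemma isCritical_castIndices
    (hcrit : ∀ i j, j ∈ critSet k n t m i ↔ ∃ b ∈ (m i).support, j < b)
    {J : Finset (Fin n)} {i : Fin t} :
    IsCritical m (castIndices J) i ↔ ↑J ⊆ critSet k n t m i :=
  ⟨fun h c hc => (hcrit i c).2 (h c (castSucc_mem_castIndices.2 hc)),
    fun h c hc => (hcrit i c).1 (h (castSucc_mem_castIndices.1 hc))⟩

lemma ekProj_eq_zero
    (hmin : ∀ i j : Fin t, i ≠ j → ¬ m i ≤ m j) (hst : StableExchange m)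
    (hcrit : ∀ i j, j ∈ critSet k n t m i ↔ ∃ b ∈ (m i).support, j < b)
    (p : ℕ)
    {z : Finset (Fin (n + 1)) →₀ MvPolynomial (Fin n) (MvPolynomial (Fin n) k)}
    (hz : z ∈ koszulNull X m) : ekProj m p z = 0 := by
  cases p with
  | zero =>
    refine (ekZero k m).injective (C_injective (Fin n) (MvPolynomial (Fin n) k) ?_)
    rw [ekProj_zero, C_aeval, specialize_zero_of_mem_nullIdeal X m (hz ∅), map_zero, C_0]
  | succ p =>
    refine (ekSucc k m p).injective (Finsupp.ext fun q => (ekProj_succ_apply m p z q).trans ?_)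
    refine beginningCoeff_of_mem_nullIdeal X hmin hst (fun c hc => ?_) (hz _)
    refine (isCritical_castIndices hcrit).2 q.vars_subset c ?_
    rcases Finset.mem_insert.1 hc with h | h
    · exact absurd h (Fin.castSucc_ne_last c)
    · exact h

lemma sub_ekLift_ekProj_mem
    (hmin : ∀ i j : Fin t, i ≠ j → ¬ m i ≤ m j) (hst : StableExchange m)
    (hcrit : ∀ i j, j ∈ critSet k n t m i ↔ ∃ b ∈ (m i).support, j < b)
    {p : ℕ}
    {z : Finset (Fin (n + 1)) →₀ MvPolynomial (Fin n) (MvPolynomial (Fin n) k)}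
    (hz : z ∈ specializedSubgroup X m) (hp : z ∈ extDegree _ _ p) :
    z - ekLift m p (ekProj m p z) ∈ koszulNull X m := by
  cases p with
  | zero =>
    have h0 : lastPart z = 0 := by
      ext1 L
      rw [lastPart_apply]
      split_ifs
      · rfl
      · exact apply_eq_zero_of_mem_extDegree hp (Finset.card_ne_zero.2 (Finset.insert_nonempty _ _))
    rw [ekLift_zero, ekProj_zero, C_aeval]
    have h1 := eq_single_add_homotopy X m hz
    rw [h0, map_zero, add_zero] at h1
    rw [← h1]
    exact (sub_self z).symm ▸ zero_mem _
  | succ p =>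
    have h0 : z ∅ = 0 := apply_eq_zero_of_mem_extDegree hp (by simp)
    have h1 := eq_single_add_homotopy X m hz
    rw [h0, map_zero, Finsupp.single_zero, zero_add] at h1
    have h2 : z - ekLift m (p + 1) (ekProj m (p + 1) z) =
        homotopy X (lastPart z - monomialLift m p (ekSucc k m p (ekProj m (p + 1) z))) := by
      rw [ekLift_succ, map_sub, ← h1]
    rw [h2]
    refine homotopy_mem_koszulNull X fun L => ?_
    rw [Finsupp.sub_apply, lastPart_apply]
    split_ifs with hL
    · rw [((mem_idealCoeff m).1 (monomialLift_mem_idealCoeff m _ L)).2 hL, sub_zero]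
      exact zero_mem _
    obtain ⟨J, rfl⟩ := exists_castIndices hL
    by_cases hJ : J.card = p
    · rw [monomialLift_apply m _ hJ]
      have h3 := sub_sum_mem_nullIdeal X hmin hst (castIndices J)
        ((mem_specializedCoeff_of_mem X m (Finset.mem_insert_self _ _)).1
          (((mem_specializedSubgroup X m).1 hz).1 (insert (Fin.last n) (castIndices J))))
      convert h3 using 3 with i
      simp only [isCritical_castIndices hcrit]
      rfl
    · rw [apply_eq_zero_of_mem_extDegree hp, apply_eq_zero_of_mem_extDegree
        (monomialLift_mem_extDegree m _) (by rwa [card_castIndices]), sub_zero]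
      · exact zero_mem _
      · rw [Finset.card_insert_of_notMem hL, card_castIndices]
        omega

end Transfer

section Differential

variable {k : Type} [Field k] {n t : ℕ} {m : Fin t → (Fin n →₀ ℕ)}

lemma koszulD_mem_specializedSubgroup {S : Type} [CommRing S] [IsDomain S] (x : Fin n → S)
    {z : Finset (Fin (n + 1)) →₀ MvPolynomial (Fin n) S} (hz : z ∈ specializedSubgroup x m) :
    koszulD (koszulCoeff x) z ∈ specializedSubgroup x m := by
  have hI := lastPart_mem_idealCoeff x m hz.1
  rw [eq_single_add_homotopy x m hz, map_add,
    koszulD_homotopy x fun L hL => ((mem_idealCoeff m).1 (hI L)).2 hL, koszulD_single,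
    Finset.sum_empty, zero_add]
  exact add_mem (homotopy_mem_specializedSubgroup x m (koszulD_mem_idealCoeff x m hI))
    (single_empty_mem_specializedSubgroup x m _)

lemma evalMonomial_X (α : Fin n →₀ ℕ) :
    evalMonomial (X : Fin n → MvPolynomial (Fin n) k) α = monomial α 1 := by
  rw [monomial_eq, C_1, one_mul]; rfl

lemma isBeginning_of_decomposition
    (hcrit : ∀ i j, j ∈ critSet k n t m i ↔ ∃ b ∈ (m i).support, j < b)
    {γ v : Fin n →₀ ℕ} {i : Fin t} (h : γ = v + m i)
    (hv : ∀ g ∈ v.support, g ∉ critSet k n t m i) : IsBeginning m i γ := by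
  rw [h, add_comm]
  refine (isBeginning_self m i).add fun l hl b hb => ?_
  by_contra! hlt
  exact hv l hl ((hcrit i l).2 ⟨b, hb, hlt⟩)

lemma beginningCoeff_koszulCoeff_mul (hmin : ∀ i j : Fin t, i ≠ j → ¬ m i ≤ m j)
    (hcrit : ∀ i j, j ∈ critSet k n t m i ↔ ∃ b ∈ (m i).support, j < b)
    {i r : Fin t} {j : Fin n} {v : Fin n →₀ ℕ} (h : Finsupp.single j 1 + m i = v + m r)
    (hv : ∀ g ∈ v.support, g ∉ critSet k n t m r) (i' : Fin t) :
    beginningCoeff (X : Fin n → MvPolynomial (Fin n) k) m i'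
        ((C (X j) - X j) * monomial (m i) 1) =
      (if i' = i then X j else 0) - if i' = r then monomial v 1 else 0 := by
  have hX : (X j : MvPolynomial (Fin n) (MvPolynomial (Fin n) k)) * monomial (m i) 1 =
      monomial (v + m r) 1 := by
    rw [← h, X, monomial_mul, one_mul]
  have hb := isBeginning_of_decomposition hcrit (γ := v + m r) rfl hv
  rw [sub_mul, map_sub, beginningCoeff_C_mul, beginningCoeff_monomial_self hmin, mul_ite, mul_one,
    mul_zero, hX, beginningCoeff_monomial]
  congr 1
  refine if_ctx_congr ⟨fun h => h.unique hmin hb, fun h => h ▸ hb⟩ (fun h => ?_) fun _ => rfl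
  rw [h, add_tsub_cancel_right, evalMonomial_X]

lemma ekProj_koszulD_homotopy_single_zero {i : Fin t} :
    ekZero k m (ekProj m 0 (koszulD (koszulCoeff X)
      (homotopy X (Finsupp.single ∅ (monomial (m i) 1))))) = monomial (m i) 1 := by
  rw [ekProj_zero, koszulD_homotopy X fun L hL =>
      Finsupp.single_eq_of_ne (by rintro rfl; exact absurd hL (by simp)),
    koszulD_single, Finset.sum_empty, map_zero, zero_add, Finsupp.single_eq_same,
    Finsupp.single_eq_same, specialize_zero_monomial, aeval_C, evalMonomial_X]
  rfl

lemma ekProj_koszulD_homotopy_single_succ {p : ℕ} {J : Finset (Fin n)} (hJ : J.Nonempty)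
    (f : MvPolynomial (Fin n) (MvPolynomial (Fin n) k)) (q : EKIndex k n t m p) :
    ekSucc k m p (ekProj m (p + 1) (koszulD (koszulCoeff X)
        (homotopy X (Finsupp.single (castIndices J) f)))) q =
      ∑ j ∈ J, if q.vars = J.erase j then (-1 : ℤ) ^ (J.filter (· < j)).card •
        beginningCoeff X m q.gen ((C (X j) - X j) * f) else 0 := by
  have h0 : ∀ K : Finset (Fin n), ∀ g : MvPolynomial (Fin n) (MvPolynomial (Fin n) k),
      ∀ L, Fin.last n ∈ L → Finsupp.single (castIndices K) g L = 0 := fun K g L hL =>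
    Finsupp.single_eq_of_ne (by rintro rfl; exact last_notMem_castIndices _ hL)
  rw [koszulD_homotopy X (h0 _ _), Finsupp.single_eq_of_ne, map_zero, Finsupp.single_zero, add_zero,
    koszulD_castIndices_single, ekProj_homotopy_apply, Finsupp.finsetSum_apply, map_sum]
  · refine Finset.sum_congr rfl fun j _ => ?_
    by_cases hq : q.vars = J.erase j
    · rw [if_pos hq, hq, Finsupp.single_eq_same]
      rcases neg_one_pow_eq_or ℤ (J.filter (· < j)).card with h | h
      all_goals
        have h' := congrArg (Int.cast : ℤ → MvPolynomial (Fin n) (MvPolynomial (Fin n) k)) h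
        push_cast at h'
        rw [h, h']
        simp
    · rw [if_neg hq, Finsupp.single_eq_of_ne fun h => hq (castIndices_injective h), map_zero]
  · intro L hL
    rw [Finsupp.finsetSum_apply]
    exact Finset.sum_eq_zero fun j _ => h0 _ _ L hL
  · rw [← Finset.card_ne_zero, ← card_castIndices, Finset.card_ne_zero] at hJ
    exact hJ.ne_empty.symm

theorem differential_eq_ekProj_koszulD (hmin : ∀ i j : Fin t, i ≠ j → ¬ m i ≤ m j)
    (hcrit : ∀ i j, j ∈ critSet k n t m i ↔ ∃ b ∈ (m i).support, j < b)
    (κ : Fin t → Fin n → Fin t) (u : Fin t → Fin n → (Fin n →₀ ℕ))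
    (hκu : ∀ i : Fin t, ∀ j ∈ critSet k n t m i,
      Finsupp.single j 1 + m i = u i j + m (κ i j) ∧
      ∀ g ∈ (u i j).support, g ∉ critSet k n t m (κ i j))
    (d : ∀ p : ℕ, EKMod k n t m (p + 1) →ₗ[MvPolynomial (Fin n) k] EKMod k n t m p)
    (hd0 : ∀ q : EKIndex k n t m 0,
      d 0 (Finsupp.single q 1) = monomial (m q.1.1) (1 : k))
    (hd : ∀ (p : ℕ) (i : Fin t) (J : Finset (Fin n)) (h1 : ↑J ⊆ critSet k n t m i)
        (h2 : J.card = p + 1),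
      d (p + 1) (ekGen k n t m i J h1 h2) =
        ∑ j ∈ J.attach, (-1 : ℤ) ^ (J.filter (· < ↑j)).card •
          ((X (↑j : Fin n) : MvPolynomial (Fin n) k) •
              ekGen k n t m (p := p) i (J.erase ↑j)
                (fun x hx => h1 (Finset.erase_subset _ _ hx))
                (by simp [Finset.card_erase_of_mem j.2, h2])
            - if hc : ↑(J.erase (↑j : Fin n)) ⊆ critSet k n t m (κ i ↑j) then
                (monomial (u i ↑j) (1 : k)) •
                  ekGen k n t m (p := p) (κ i ↑j) (J.erase ↑j) hc
                    (by simp [Finset.card_erase_of_mem j.2, h2])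
              else 0))
    (p : ℕ) (a : EKMod k n t m (p + 1)) :
    d p a = ekProj m p (koszulD (koszulCoeff X) (ekLift m (p + 1) a)) := by
  let ψ : EKMod k n t m (p + 1) →ₗ[MvPolynomial (Fin n) k] EKMod k n t m p :=
    ekProj m p ∘ₗ (koszulD (koszulCoeff X)).restrictScalars _ ∘ₗ ekLift m (p + 1)
  suffices h : d p ∘ₗ (ekSucc k m p).symm.toLinearMap = ψ ∘ₗ (ekSucc k m p).symm.toLinearMap from
    LinearMap.congr_fun h (ekSucc k m p a)
  refine Finsupp.lhom_ext' fun q => LinearMap.ext_ring ?_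
  change d p ((ekSucc k m p).symm (Finsupp.single q 1)) = ekProj m p (koszulD (koszulCoeff X)
    (ekLift m (p + 1) ((ekSucc k m p).symm (Finsupp.single q 1))))
  rw [ekLift_succ, LinearEquiv.apply_symm_apply, monomialLift_single, C_1, one_mul]
  cases p with
  | zero =>
    refine (ekZero k m).injective ?_
    have hq : castIndices q.vars = ∅ := by
      rw [← Finset.card_eq_zero, card_castIndices, q.card_vars]
    rw [hq, ekProj_koszulD_homotopy_single_zero]
    exact hd0 q
  | succ p =>
    refine (ekSucc k m p).injective (Finsupp.ext fun q' => ?_)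
    rw [ekProj_koszulD_homotopy_single_succ (Finset.card_pos.1 (by rw [q.card_vars]; omega))]
    have hgen : ∀ i J h1 h2, ekSucc k m p (ekGen k n t m i J h1 h2) q' =
        if q'.gen = i ∧ q'.vars = J then 1 else 0 := fun i J h1 h2 => by
      change Finsupp.single (ekIndex m i J h1 h2) (1 : MvPolynomial (Fin n) k) q' = _
      by_cases h : q'.gen = i ∧ q'.vars = J
      · rw [if_pos h, ← ekIndex_eq_iff.2 h, Finsupp.single_eq_same]
      · rw [if_neg h, Finsupp.single_eq_of_ne fun h' => h (ekIndex_eq_iff.1 h')]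
    have hdq := congrArg (fun b => ekSucc k m p b q')
      (hd p q.gen q.vars q.vars_subset q.card_vars)
    refine Eq.trans hdq ?_
    simp only [map_sum, Finsupp.finsetSum_apply, map_zsmul, map_sub, map_smul,
      Finsupp.smul_apply, Finsupp.sub_apply]
    rw [← Finset.sum_attach q.vars]
    refine Finset.sum_congr rfl fun j _ => ?_
    obtain ⟨h1, h2⟩ := hκu q.gen j (q.vars_subset j.2)
    have hdite : ekSucc k m p (if hc : ↑(q.vars.erase (↑j : Fin n)) ⊆
          critSet k n t m (κ q.gen ↑j) then
        (monomial (u q.gen ↑j) (1 : k)) •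
          ekGen k n t m (p := p) (κ q.gen ↑j) (q.vars.erase ↑j) hc
            (by simp [Finset.card_erase_of_mem j.2, q.card_vars])
        else 0) q' = if q'.gen = κ q.gen j ∧ q'.vars = q.vars.erase j then
          monomial (u q.gen j) 1 else 0 := by
      split_ifs with hc h3 h3
      · rw [map_smul, Finsupp.smul_apply, hgen, if_pos h3, smul_eq_mul, mul_one]
      · rw [map_smul, Finsupp.smul_apply, hgen, if_neg h3, smul_zero]
      · exact absurd (h3.1 ▸ h3.2 ▸ q'.vars_subset) hc
      · rw [map_zero, Finsupp.zero_apply]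
    refine (congrArg₂ (fun a b : MvPolynomial (Fin n) k =>
      (-1 : ℤ) ^ (q.vars.filter (· < ↑j)).card • ((X ↑j : MvPolynomial (Fin n) k) • a - b))
      (hgen q.gen (q.vars.erase j) _ _) hdite).trans ?_
    rw [beginningCoeff_koszulCoeff_mul hmin hcrit h1 h2]
    by_cases h3 : q'.vars = q.vars.erase j
    · simp only [h3, and_true, if_true, smul_eq_mul, mul_ite, mul_one, mul_zero]
    · simp only [h3, and_false, if_false, smul_zero, sub_self]

end Differential

section Product

variable {k : Type} [Field k] {n t : ℕ} (m : Fin t → (Fin n →₀ ℕ))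

/-- The product on the Eliahou–Kervaire complex induced from the exterior algebra. -/
noncomputable def ekMul (p q : ℕ) : EKMod k n t m p →ₗ[MvPolynomial (Fin n) k]
    EKMod k n t m q →ₗ[MvPolynomial (Fin n) k] EKMod k n t m (p + q) :=
  LinearMap.mk₂ (MvPolynomial (Fin n) k)
    (fun a b => ekProj m (p + q) (extMul _ _ (ekLift m p a) (ekLift m q b)))
    (fun a a' b => by rw [map_add, map_add, LinearMap.add_apply, map_add])
    (fun s a b => by
      rw [map_smul, ← LinearMap.flip_apply, LinearMap.map_smul_of_tower, map_smul,
        LinearMap.flip_apply])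
    (fun a b b' => by rw [map_add, map_add, map_add])
    (fun s a b => by rw [map_smul, LinearMap.map_smul_of_tower, map_smul])

lemma ekMul_apply (p q : ℕ) (a : EKMod k n t m p) (b : EKMod k n t m q) :
    ekMul m p q a b = ekProj m (p + q) (extMul _ _ (ekLift m p a) (ekLift m q b)) := rfl

lemma ekCast_ekProj {p q : ℕ} (h : p = q)
    (z : Finset (Fin (n + 1)) →₀ MvPolynomial (Fin n) (MvPolynomial (Fin n) k)) :
    ekCast k n t m h (ekProj m p z) = ekProj m q z := by
  subst h; rfl

variable {m}

lemma ekMul_ekProj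
    (hmin : ∀ i j : Fin t, i ≠ j → ¬ m i ≤ m j) (hst : StableExchange m)
    (hcrit : ∀ i j, j ∈ critSet k n t m i ↔ ∃ b ∈ (m i).support, j < b)
    {p q : ℕ}
    {z w : Finset (Fin (n + 1)) →₀ MvPolynomial (Fin n) (MvPolynomial (Fin n) k)}
    (hz : z ∈ specializedSubgroup X m) (hp : z ∈ extDegree _ _ p)
    (hw : w ∈ specializedSubgroup X m) (hq : w ∈ extDegree _ _ q) :
    ekMul m p q (ekProj m p z) (ekProj m q w) = ekProj m (p + q) (extMul _ _ z w) := by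
  have h1 := extMul_mem_koszulNull_right X (sub_ekLift_ekProj_mem hmin hst hcrit hz hp) w
  have h2 := extMul_mem_koszulNull_left X (ekLift m p (ekProj m p z))
    (sub_ekLift_ekProj_mem hmin hst hcrit hw hq)
  have h := ekProj_eq_zero hmin hst hcrit (p + q) (add_mem h1 h2)
  rw [map_sub, map_sub, LinearMap.sub_apply, sub_add_sub_cancel, map_sub, sub_eq_zero] at h
  exact h.symm

lemma ekProj_koszulD_ekLift_ekProj
    (hmin : ∀ i j : Fin t, i ≠ j → ¬ m i ≤ m j) (hst : StableExchange m)
    (hcrit : ∀ i j, j ∈ critSet k n t m i ↔ ∃ b ∈ (m i).support, j < b)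
    {p : ℕ}
    {z : Finset (Fin (n + 1)) →₀ MvPolynomial (Fin n) (MvPolynomial (Fin n) k)}
    (hz : z ∈ specializedSubgroup X m) (hp : z ∈ extDegree _ _ (p + 1)) :
    ekProj m p (koszulD (koszulCoeff X) (ekLift m (p + 1) (ekProj m (p + 1) z))) =
      ekProj m p (koszulD (koszulCoeff X) z) := by
  have h := ekProj_eq_zero hmin hst hcrit p
    (koszulD_mem_koszulNull X (sub_ekLift_ekProj_mem hmin hst hcrit hz hp))
  rw [map_sub, map_sub, sub_eq_zero] at h
  exact h.symm

lemma ekMul_ekProj_right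
    (hmin : ∀ i j : Fin t, i ≠ j → ¬ m i ≤ m j) (hst : StableExchange m)
    (hcrit : ∀ i j, j ∈ critSet k n t m i ↔ ∃ b ∈ (m i).support, j < b)
    {p q : ℕ} (a : EKMod k n t m p)
    {w : Finset (Fin (n + 1)) →₀ MvPolynomial (Fin n) (MvPolynomial (Fin n) k)}
    (hw : w ∈ specializedSubgroup X m) (hq : w ∈ extDegree _ _ q) :
    ekMul m p q a (ekProj m q w) = ekProj m (p + q) (extMul _ _ (ekLift m p a) w) := by
  conv_lhs => rw [← ekProj_ekLift hmin p a]
  exact ekMul_ekProj hmin hst hcrit (ekLift_mem_specializedSubgroup m p a)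
    (ekLift_mem_extDegree m p a) hw hq

lemma ekMul_ekProj_left
    (hmin : ∀ i j : Fin t, i ≠ j → ¬ m i ≤ m j) (hst : StableExchange m)
    (hcrit : ∀ i j, j ∈ critSet k n t m i ↔ ∃ b ∈ (m i).support, j < b)
    {p q : ℕ}
    {z : Finset (Fin (n + 1)) →₀ MvPolynomial (Fin n) (MvPolynomial (Fin n) k)}
    (hz : z ∈ specializedSubgroup X m) (hp : z ∈ extDegree _ _ p) (b : EKMod k n t m q) :
    ekMul m p q (ekProj m p z) b = ekProj m (p + q) (extMul _ _ z (ekLift m q b)) := by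
  conv_lhs => rw [← ekProj_ekLift hmin q b]
  exact ekMul_ekProj hmin hst hcrit hz hp (ekLift_mem_specializedSubgroup m q b)
    (ekLift_mem_extDegree m q b)

lemma ekMul_assoc
    (hmin : ∀ i j : Fin t, i ≠ j → ¬ m i ≤ m j) (hst : StableExchange m)
    (hcrit : ∀ i j, j ∈ critSet k n t m i ↔ ∃ b ∈ (m i).support, j < b)
    (p q r : ℕ) (a : EKMod k n t m p) (b : EKMod k n t m q) (c : EKMod k n t m r) :
    ekMul m (p + q) r (ekMul m p q a b) c =
      ekCast k n t m (Nat.add_assoc p q r).symm (ekMul m p (q + r) a (ekMul m q r b c)) := by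
  rw [ekMul_apply m p q, ekMul_apply m q r, ekMul_ekProj_left hmin hst hcrit,
    ekMul_ekProj_right hmin hst hcrit, extMul_assoc, ekCast_ekProj]
  · exact extMul_mem_specializedSubgroup _ _ (ekLift_mem_extDegree m q b)
      (ekLift_mem_specializedSubgroup m q b) (ekLift_mem_specializedSubgroup m r c)
  · exact extMul_mem_extDegree (ekLift_mem_extDegree m q b) (ekLift_mem_extDegree m r c)
  · exact extMul_mem_specializedSubgroup _ _ (ekLift_mem_extDegree m p a)
      (ekLift_mem_specializedSubgroup m p a) (ekLift_mem_specializedSubgroup m q b)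
  · exact extMul_mem_extDegree (ekLift_mem_extDegree m p a) (ekLift_mem_extDegree m q b)

lemma ekMul_zero_left
    (hmin : ∀ i j : Fin t, i ≠ j → ¬ m i ≤ m j)
    (q : ℕ) (s : MvPolynomial (Fin n) k) (b : EKMod k n t m q) :
    ekMul m 0 q ((ekZero k m).symm s) b =
      ekCast k n t m (Nat.zero_add q).symm (s • b) := by
  rw [ekMul_apply, ekLift_zero, LinearEquiv.apply_symm_apply, extMul_single_empty,
    ← algebraMap_eq, algebraMap_smul, map_smul, ← ekCast_ekProj m (Nat.zero_add q).symm,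
    ekProj_ekLift hmin, map_smul]

lemma ekMul_comm (p q : ℕ) (a : EKMod k n t m p) (b : EKMod k n t m q) :
    ekMul m p q a b =
      (-1 : ℤ) ^ (p * q) • ekCast k n t m (Nat.add_comm q p) (ekMul m q p b a) := by
  rw [ekMul_apply, ekMul_apply, ekCast_ekProj,
    extMul_comm (ekLift_mem_extDegree m p a) (ekLift_mem_extDegree m q b),
    LinearMap.map_smul_of_tower]

lemma ekMul_zero_right
    (hmin : ∀ i j : Fin t, i ≠ j → ¬ m i ≤ m j)
    (p : ℕ) (a : EKMod k n t m p) (s : MvPolynomial (Fin n) k) :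
    ekMul m p 0 a ((ekZero k m).symm s) = s • a := by
  rw [ekMul_comm, ekMul_zero_left hmin, Nat.mul_zero, pow_zero, one_smul,
    ← ekProj_ekLift hmin p (s • a), ekCast_ekProj, ekCast_ekProj]
  rfl

lemma ekProj_koszulD_ekMul
    (hmin : ∀ i j : Fin t, i ≠ j → ¬ m i ≤ m j) (hst : StableExchange m)
    (hcrit : ∀ i j, j ∈ critSet k n t m i ↔ ∃ b ∈ (m i).support, j < b)
    (p q : ℕ) (h : p + (q + 1) = p + 1 + q) (a : EKMod k n t m (p + 1))
    (b : EKMod k n t m (q + 1)) :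
    ekProj m (p + 1 + q) (koszulD (koszulCoeff X)
      (ekLift m (p + 1 + q + 1) (ekMul m (p + 1) (q + 1) a b))) =
    ekCast k n t m h
        (ekMul m p (q + 1) (ekProj m p (koszulD (koszulCoeff X) (ekLift m (p + 1) a))) b) +
      (-1 : ℤ) ^ (p + 1) •
        ekMul m (p + 1) q a (ekProj m q (koszulD (koszulCoeff X) (ekLift m (q + 1) b))) := by
  have ha := ekLift_mem_specializedSubgroup m _ a
  have ha' := ekLift_mem_extDegree m _ a
  have hb := ekLift_mem_specializedSubgroup m _ b
  have hb' := ekLift_mem_extDegree m _ b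
  refine (ekProj_koszulD_ekLift_ekProj hmin hst hcrit (p := p + 1 + q)
    (extMul_mem_specializedSubgroup _ _ ha' ha hb)
    (extMul_mem_extDegree (q := q + 1) ha' hb')).trans ?_
  rw [koszulD_mul _ ha', map_add, LinearMap.map_smul_of_tower, ekMul_ekProj_left hmin hst hcrit
      (koszulD_mem_specializedSubgroup X ha) (koszulD_mem_extDegree _ ha'),
    ekMul_ekProj_right hmin hst hcrit a (koszulD_mem_specializedSubgroup X hb)
      (koszulD_mem_extDegree _ hb'), ekCast_ekProj]

lemma map_ekCast (d : ∀ p : ℕ, EKMod k n t m (p + 1) →ₗ[MvPolynomial (Fin n) k] EKMod k n t m p)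
    {p q : ℕ} (h : p = q) (b : EKMod k n t m (p + 1)) :
    d q (ekCast k n t m (congrArg Nat.succ h : p + 1 = q + 1) b) = ekCast k n t m h (d p b) := by
  subst h; rfl

end Product

/-- Let `I ⊆ S = k[x_1,…,x_n]` be a stable monomial ideal with minimal
monomial generators in decreasing lexicographic order, and let `G̃` be the associated
Eliahou–Kervaire-type complex, the minimal free resolution of `S/I`.  Then `G̃` admits a
DGA structure: there are `S`-bilinear maps `μ : G̃_p × G̃_q → G̃_{p+q}` agreeing with the
ring multiplication of `S` in degree `0`, with `1 ∈ G̃_0` a two-sided identity, graded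
commutative, associative, and satisfying the Leibniz rule (`d` interpreted as `0` on
`G̃_0`). -/
theorem stmt_13 (k : Type) [Field k] (n t : ℕ)
    (m : Fin t → (Fin n →₀ ℕ))
    (hmin : ∀ i j : Fin t, i ≠ j → ¬ m i ≤ m j)
    -- `I` is stable
    (hstable : ∀ α : Fin n →₀ ℕ,
      monomial α (1 : k) ∈ Ideal.span (Set.range fun i => monomial (m i) (1 : k)) →
      ∀ b ∈ α.support, (∀ l ∈ α.support, l ≤ b) →
      ∀ i : Fin n, i < b →
        monomial (α + Finsupp.single i 1 - Finsupp.single b 1) (1 : k) ∈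
          Ideal.span (Set.range fun i => monomial (m i) (1 : k)))
    -- the generators are listed in decreasing lexicographic order
    (hsort : ∀ i j : Fin t, i < j → toLex (m j) < toLex (m i))
    -- the decompositions `x_j·m_i = u(i,j)·m_{κ(i,j)}`
    (κ : Fin t → Fin n → Fin t) (u : Fin t → Fin n → (Fin n →₀ ℕ))
    (hκu : ∀ i : Fin t, ∀ j ∈ critSet k n t m i,
      Finsupp.single j 1 + m i = u i j + m (κ i j) ∧
      ∀ g ∈ (u i j).support, g ∉ critSet k n t m (κ i j))
    -- the differential of `G̃`
    (d : ∀ p : ℕ, EKMod k n t m (p + 1) →ₗ[MvPolynomial (Fin n) k] EKMod k n t m p)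
    (hd0 : ∀ q : EKIndex k n t m 0,
      d 0 (Finsupp.single q 1) = monomial (m q.1.1) (1 : k))
    (hd : ∀ (p : ℕ) (i : Fin t) (J : Finset (Fin n)) (h1 : ↑J ⊆ critSet k n t m i)
        (h2 : J.card = p + 1),
      d (p + 1) (ekGen k n t m i J h1 h2) =
        ∑ j ∈ J.attach, (-1 : ℤ) ^ (J.filter (· < ↑j)).card •
          ((X (↑j : Fin n) : MvPolynomial (Fin n) k) •
              ekGen k n t m (p := p) i (J.erase ↑j)
                (fun x hx => h1 (Finset.erase_subset _ _ hx))
                (by simp [Finset.card_erase_of_mem j.2, h2])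
            - if hc : ↑(J.erase (↑j : Fin n)) ⊆ critSet k n t m (κ i ↑j) then
                (monomial (u i ↑j) (1 : k)) •
                  ekGen k n t m (p := p) (κ i ↑j) (J.erase ↑j) hc
                    (by simp [Finset.card_erase_of_mem j.2, h2])
              else 0)) :
    -- `G̃` admits the structure of a differential graded algebra:
    ∃ mul : ∀ p q : ℕ,
        EKMod k n t m p →ₗ[MvPolynomial (Fin n) k]
          EKMod k n t m q →ₗ[MvPolynomial (Fin n) k] EKMod k n t m (p + q),
      -- `mul` agrees with the ring multiplication of `S` on `G̃_0 × G̃_0`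
      (∀ a b : MvPolynomial (Fin n) k, mul 0 0 a b = a * b)
      -- `1 ∈ G̃_0 = S` is a two-sided identity
      ∧ (∀ (p : ℕ) (x : EKMod k n t m p),
          ekCast k n t m (Nat.zero_add p) (mul 0 p (1 : MvPolynomial (Fin n) k) x) = x
          ∧ mul p 0 x (1 : MvPolynomial (Fin n) k) = x)
      -- graded commutativity
      ∧ (∀ (p q : ℕ) (x : EKMod k n t m p) (y : EKMod k n t m q),
          mul p q x y
            = ((-1 : ℤ) ^ (p * q)) • ekCast k n t m (Nat.add_comm q p) (mul q p y x))
      -- associativity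
      ∧ (∀ (p q r : ℕ) (x : EKMod k n t m p) (y : EKMod k n t m q) (z : EKMod k n t m r),
          mul (p + q) r (mul p q x y) z
            = ekCast k n t m (Nat.add_assoc p q r).symm (mul p (q + r) x (mul q r y z)))
      -- Leibniz rule, both factors of positive degree
      ∧ (∀ (p q : ℕ) (x : EKMod k n t m (p + 1)) (y : EKMod k n t m (q + 1)),
          d (p + 1 + q) (mul (p + 1) (q + 1) x y)
            = ekCast k n t m (by omega : p + (q + 1) = p + 1 + q)
                (mul p (q + 1) (d p x) y)
              + (-1 : ℤ) ^ (p + 1) • mul (p + 1) q x (d q y))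
      -- Leibniz rule, first factor of degree 0 (`d = 0` on `G̃_0`)
      ∧ (∀ (q : ℕ) (x : MvPolynomial (Fin n) k) (y : EKMod k n t m (q + 1)),
          d (0 + q) (mul 0 (q + 1) x y) = mul 0 q x (d q y))
      -- Leibniz rule, second factor of degree 0 (`d = 0` on `G̃_0`)
      ∧ (∀ (p : ℕ) (x : EKMod k n t m (p + 1)) (y : MvPolynomial (Fin n) k),
          d p (mul (p + 1) 0 x y) = mul p 0 (d p x) y) := by
  have hst := stableExchange_of_stable k hstable
  have hcrit : ∀ i j, j ∈ critSet k n t m i ↔ ∃ b ∈ (m i).support, j < b := fun i j =>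
    mem_critSet_iff_lt k hmin hst hsort
  have hD := differential_eq_ekProj_koszulD hmin hcrit κ u hκu d hd0 hd
  refine ⟨ekMul m, fun a b => ?_, fun p x => ⟨?_, ?_⟩, ekMul_comm, ekMul_assoc hmin hst hcrit,
    fun p q x y => ?_, fun q x y => ?_, fun p x y => ?_⟩
  · exact (ekMul_zero_right hmin 0 a b).trans (mul_comm b a)
  · refine (congrArg _ (ekMul_zero_left hmin p 1 x)).trans ?_
    rw [one_smul, ← ekProj_ekLift hmin p x, ekCast_ekProj, ekCast_ekProj]
  · exact (ekMul_zero_right hmin p x 1).trans (one_smul _ x)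
  · rw [hD, hD p, hD q]
    exact ekProj_koszulD_ekMul hmin hst hcrit p q _ x y
  · refine (congrArg (d (0 + q)) (ekMul_zero_left hmin (q + 1) x y)).trans
      (Eq.trans ?_ (ekMul_zero_left hmin q x (d q y)).symm)
    rw [← map_smul (d q)]
    exact map_ekCast d (Nat.zero_add q).symm (x • y)
  · refine (congrArg (d p) (ekMul_zero_right hmin (p + 1) x y)).trans
      (Eq.trans ?_ (ekMul_zero_right hmin p (d p x) y).symm)
    exact map_smul (d p) y x
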